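/- arXiv:1912.03900 — 4 statements merged into one kernel-verified Lean document; each statement's English description precedes it below -/
import Mathlib

section
/- Let S ⊂ ℝ^4 be the set of six points (0,0,0,0), (0,0,0,1), (0,0,1,0), (0,1,0,0), (1,0,0,1), (1,1,1,0), and let P be the convex hull of S. Then P is a 4-polytope whose vertex set is exactly S, P is 2-neighborly, and P has exactly 9 facets. -/
open Set

/-- A polytope is the convex hull of a finite set of points. -/
def IsPolytope {N : ℕ} (P : Set (Fin N → ℝ)) : Prop :=
  ∃ S : Finset (Fin N → ℝ), P = convexHull ℝ (S : Set (Fin N → ℝ))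

/-- The dimension of a set: the dimension of its affine span. -/
noncomputable def pdim {N : ℕ} (P : Set (Fin N → ℝ)) : ℕ :=
  Module.finrank ℝ (affineSpan ℝ P).direction

/-- A vertex is a 0-dimensional (exposed) face, i.e. an exposed singleton. -/
def IsVertex {N : ℕ} (P : Set (Fin N → ℝ)) (v : Fin N → ℝ) : Prop :=
  IsExposed ℝ P {v}

/-- The set of vertices of `P`. -/
def vertexSet {N : ℕ} (P : Set (Fin N → ℝ)) : Set (Fin N → ℝ) :=
  {v | IsVertex P v}

/-- A facet is a nonempty exposed face of dimension one less than the polytope. -/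
def IsFacetOf {N : ℕ} (P F : Set (Fin N → ℝ)) : Prop :=
  IsExposed ℝ P F ∧ F.Nonempty ∧ pdim F + 1 = pdim P

/-- The set of facets of `P`. -/
def facetSet {N : ℕ} (P : Set (Fin N → ℝ)) : Set (Set (Fin N → ℝ)) :=
  {F | IsFacetOf P F}

/-- A polytope is 2-neighborly if every pair of distinct vertices is the vertex set of
an edge (1-dimensional face), i.e. the segment between them is an exposed face. -/
def TwoNeighborly {N : ℕ} (P : Set (Fin N → ℝ)) : Prop :=
  ∀ u v : Fin N → ℝ, IsVertex P u → IsVertex P v → u ≠ v →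
    IsExposed ℝ P (convexHull ℝ {u, v}) ∧ pdim (convexHull ℝ ({u, v} : Set (Fin N → ℝ))) = 1

/-- A polytope is 2-simplicial if every 2-dimensional face has exactly 3 vertices. -/
def TwoSimplicial {N : ℕ} (P : Set (Fin N → ℝ)) : Prop :=
  ∀ F : Set (Fin N → ℝ), IsExposed ℝ P F → F.Nonempty → pdim F = 2 →
    (vertexSet F).ncard = 3

/-- A polytope is a pyramid if some vertex (the apex) is not in the affine span
of the remaining vertices. -/
def IsPyramid {N : ℕ} (P : Set (Fin N → ℝ)) : Prop :=
  ∃ v : Fin N → ℝ, IsVertex P v ∧ v ∉ affineSpan ℝ (vertexSet P \ {v})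

/-- `P` is a pyramid over `Q`: `Q` is a facet of `P` and `P` is the convex hull of `Q`
together with one additional point (the apex) not in the affine span of `Q`. -/
def IsPyramidOver {N : ℕ} (P Q : Set (Fin N → ℝ)) : Prop :=
  IsFacetOf P Q ∧ ∃ a : Fin N → ℝ, a ∉ affineSpan ℝ Q ∧ P = convexHull ℝ (Q ∪ {a})

/-- `P` is a `k`-fold pyramid over `Q`. -/
def IsKFoldPyramidOver {N : ℕ} : ℕ → Set (Fin N → ℝ) → Set (Fin N → ℝ) → Prop
  | 0, P, Q => P = Q
  | k + 1, P, Q => ∃ R : Set (Fin N → ℝ), IsKFoldPyramidOver k R Q ∧ IsPyramidOver P R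

/-- The six points, split into the two sides of their unique affine dependence. -/
def points : Fin 3 ⊕ Fin 3 → Fin 4 → ℝ :=
  Sum.elim ![![0,0,0,0], ![0,0,0,1], ![1,1,1,0]] ![![0,0,1,0], ![0,1,0,0], ![1,0,0,1]]

/-- The signs of the affine dependence between the six points. -/
def dependenceSign : Fin 3 ⊕ Fin 3 → ℝ := Sum.elim (fun _ => 1) (fun _ => -1)

lemma dependenceSign_mul_self (k : Fin 3 ⊕ Fin 3) :
    dependenceSign k * dependenceSign k = 1 := by
  rcases k with k | k <;> simp [dependenceSign]

lemma dependenceSign_ne_zero (k : Fin 3 ⊕ Fin 3) : dependenceSign k ≠ 0 := by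
  rcases k with k | k <;> simp [dependenceSign]

/-- Values on the six points compatible with the affine dependence extend to an affine function. -/
lemma exists_affine_extension (h : Fin 3 ⊕ Fin 3 → ℝ) (hh : ∑ k, dependenceSign k * h k = 0) :
    ∃ (l : StrongDual ℝ (Fin 4 → ℝ)) (m : ℝ), ∀ k, l (points k) + m = h k := by
  let c : Fin 4 → ℝ := ![h (.inr 2) - h (.inl 1), h (.inr 1) - h (.inl 0),
    h (.inr 0) - h (.inl 0), h (.inl 1) - h (.inl 0)]
  refine ⟨∑ i, c i • ContinuousLinearMap.proj i, h (.inl 0), ?_⟩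
  simp [Fintype.sum_sum_type, Fin.sum_univ_three, dependenceSign] at hh
  rintro (k | k) <;> fin_cases k <;>
    (simp [points, c, Fin.sum_univ_four]; try linarith)

lemma affineIndependent_points_ne (k₀ : Fin 3 ⊕ Fin 3) :
    AffineIndependent ℝ (fun k : {k // k ≠ k₀} => points k) := by
  rw [affineIndependent_iff]
  intro s w hw hs k₁ hk₁
  obtain ⟨l, m, hl⟩ := exists_affine_extension
    (Pi.single k₁.1 (dependenceSign k₁) - Pi.single k₀ (dependenceSign k₀)) (by
      simp [mul_sub, Finset.sum_sub_distrib, Pi.single_apply, dependenceSign_mul_self])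
  have h₁ : ∑ k ∈ s, w k * (l (points k) + m) = 0 := by
    have h₂ := congrArg l hs
    simp only [map_sum, map_smul, smul_eq_mul, map_zero] at h₂
    simp only [mul_add, Finset.sum_add_distrib, h₂, ← Finset.sum_mul, hw]
    simp
  rw [Finset.sum_eq_single k₁] at h₁
  · simpa [hl, k₁.2, dependenceSign_ne_zero] using h₁
  · intro k _ hk
    simp [hl, k.2, Subtype.coe_injective.ne hk]
  · exact fun h => (h hk₁).elim

lemma pdim_convexHull_points (K : Finset (Fin 3 ⊕ Fin 3)) (hK : K.Nonempty)
    {k₀ : Fin 3 ⊕ Fin 3} (hk₀ : k₀ ∉ K) :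
    pdim (convexHull ℝ (points '' K)) + 1 = K.card := by
  have hne : ∀ k ∈ (K : Set (Fin 3 ⊕ Fin 3)), k ≠ k₀ := by rintro k hk rfl; exact hk₀ hk
  have hi : AffineIndependent ℝ (fun k : (K : Set (Fin 3 ⊕ Fin 3)) => points k) :=
    (affineIndependent_points_ne k₀).comp_embedding (Subtype.impEmbedding _ _ hne)
  have : Nonempty (K : Set (Fin 3 ⊕ Fin 3)) := hK.to_subtype
  rw [pdim, affineSpan_convexHull, direction_affineSpan, image_eq_range]
  simpa using hi.finrank_vectorSpan_add_one

/-- A set of indices missing a point on each side of the dependence is cut out by a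
supporting hyperplane. -/
lemma exists_supporting (K : Finset (Fin 3 ⊕ Fin 3)) {i j : Fin 3} (hi : .inl i ∉ K)
    (hj : .inr j ∉ K) :
    ∃ (l : StrongDual ℝ (Fin 4 → ℝ)) (m : ℝ), (∀ k ∈ K, l (points k) = m) ∧
      ∀ k ∉ K, l (points k) < m := by
  let A : Finset (Fin 3) := {a | Sum.inl a ∉ K}
  let B : Finset (Fin 3) := {b | Sum.inr b ∉ K}
  have hA : (0 : ℝ) < A.card := by
    exact_mod_cast Finset.card_pos.2 ⟨i, by simpa [A] using hi⟩
  have hB : (0 : ℝ) < B.card := by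
    exact_mod_cast Finset.card_pos.2 ⟨j, by simpa [B] using hj⟩
  obtain ⟨l, m, hl⟩ := exists_affine_extension
    (Sum.elim (fun a => if a ∈ A then -(A.card : ℝ)⁻¹ else 0)
      (fun b => if b ∈ B then -(B.card : ℝ)⁻¹ else 0)) (by
      simp [Fintype.sum_sum_type, dependenceSign, hA.ne', hB.ne'])
  refine ⟨l, -m, fun k hk => ?_, fun k hk => ?_⟩
  · have := hl k
    rcases k with k | k <;> simp [A, B, hk] at this <;> linarith
  · have := hl k
    have := inv_pos.2 hA
    have := inv_pos.2 hB
    rcases k with k | k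
    · have h₁ : k ∈ A := by simpa [A] using hk
      simp only [Sum.elim_inl, h₁, if_true] at *
      linarith
    · have h₁ : k ∈ B := by simpa [B] using hk
      simp only [Sum.elim_inr, h₁, if_true] at *
      linarith

lemma points_mem_convexHull_image_iff (K : Finset (Fin 3 ⊕ Fin 3)) {i j : Fin 3}
    (hi : .inl i ∉ K) (hj : .inr j ∉ K) (k : Fin 3 ⊕ Fin 3) :
    points k ∈ convexHull ℝ (points '' K) ↔ k ∈ K := by
  refine ⟨fun hk => ?_, fun hk => subset_convexHull ℝ _ ⟨k, hk, rfl⟩⟩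
  obtain ⟨l, m, h₁, h₂⟩ := exists_supporting K hi hj
  have hsub : convexHull ℝ (points '' K) ⊆ {x | l x = m} :=
    convexHull_min (by rintro _ ⟨a, ha, rfl⟩; exact h₁ a ha)
      (convex_hyperplane l.toLinearMap.isLinear m)
  by_contra hkK
  exact (h₂ k hkK).ne (hsub hk)

/-- An exposed face of the convex hull of a finite set is the convex hull of the points
of that set which it contains. -/
lemma eq_convexHull_inter_of_isExposed {N : ℕ} {S F : Set (Fin N → ℝ)} (hS : S.Finite)
    (hF : IsExposed ℝ (convexHull ℝ S) F) : F = convexHull ℝ (S ∩ F) := by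
  have hconv := hF.convex (convex_convexHull ℝ S)
  have hcomp := hF.isCompact (hS.isCompact_convexHull ℝ)
  refine subset_antisymm ?_ (convexHull_min inter_subset_right hconv)
  have hsub : F.extremePoints ℝ ⊆ S ∩ F := fun x hx =>
    ⟨extremePoints_convexHull_subset (hF.isExtreme.extremePoints_subset_extremePoints hx), hx.1⟩
  conv_lhs => rw [← closure_convexHull_extremePoints hcomp hconv]
  exact closure_minimal (convexHull_mono hsub) ((hS.inter_of_left F).isClosed_convexHull ℝ)

lemma isExposed_convexHull_image (K : Finset (Fin 3 ⊕ Fin 3)) {i j : Fin 3}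
    (hi : .inl i ∉ K) (hj : .inr j ∉ K) :
    IsExposed ℝ (convexHull ℝ (range points)) (convexHull ℝ (points '' K)) := by
  rcases K.eq_empty_or_nonempty with rfl | ⟨a, ha⟩
  · simpa using isExposed_empty
  obtain ⟨l, m, h₁, h₂⟩ := exists_supporting K hi hj
  have hle : ∀ x ∈ convexHull ℝ (range points), l x ≤ m := by
    refine convexHull_min (t := {x | l x ≤ m}) ?_ (convex_halfSpace_le l.toLinearMap.isLinear m)
    rintro _ ⟨k, rfl⟩
    by_cases hk : k ∈ K
    · exact (h₁ k hk).le
    · exact (h₂ k hk).le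
  have hmem : ∀ k, points k ∈ convexHull ℝ (range points) := fun k =>
    subset_convexHull ℝ _ (mem_range_self k)
  have hexp : IsExposed ℝ (convexHull ℝ (range points))
      (l.toExposed (convexHull ℝ (range points))) := 
    ContinuousLinearMap.toExposed.isExposed
  have hS : range points ∩ l.toExposed (convexHull ℝ (range points)) = points '' K := by
    ext x
    constructor
    · rintro ⟨⟨k, rfl⟩, -, hk⟩
      refine ⟨k, ?_, rfl⟩
      by_contra hkK
      exact ((h₁ a ha).symm.le.trans (hk _ (hmem a))).not_gt (h₂ k hkK)
    · rintro ⟨k, hk, rfl⟩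
      exact ⟨mem_range_self k, hmem k, fun y hy => (hle y hy).trans (h₁ k hk).ge⟩
  rwa [eq_convexHull_inter_of_isExposed (finite_range points) hexp, hS] at hexp

lemma exists_notMem_of_card_le_two (K : Finset (Fin 3 ⊕ Fin 3)) (hK : K.card ≤ 2) :
    (∃ i, Sum.inl i ∉ K) ∧ ∃ j, Sum.inr j ∉ K := by
  constructor <;> by_contra! h
  · have := Finset.card_le_card (s := Finset.univ.map Function.Embedding.inl) (t := K)
      (by intro x; simp; rintro i rfl; exact h i)
    simp at this; omega
  · have := Finset.card_le_card (s := Finset.univ.map Function.Embedding.inr) (t := K)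
      (by intro x; simp; rintro i rfl; exact h i)
    simp at this; omega

lemma pdim_convexHull_range_points : pdim (convexHull ℝ (range points)) = 4 := by
  have h := pdim_convexHull_points {Sum.inl 0}ᶜ ⟨.inr 0, by simp⟩ (k₀ := .inl 0) (by simp)
  have hcard : ({Sum.inl 0}ᶜ : Finset (Fin 3 ⊕ Fin 3)).card = 5 := by decide
  rw [hcard] at h
  have hle : pdim (convexHull ℝ (points '' ({Sum.inl 0}ᶜ : Finset (Fin 3 ⊕ Fin 3)))) ≤
      pdim (convexHull ℝ (range points)) :=
    Submodule.finrank_mono (AffineSubspace.direction_le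
      (affineSpan_mono ℝ (convexHull_mono (image_subset_range _ _))))
  have hge : pdim (convexHull ℝ (range points)) ≤ 4 := by
    simpa [pdim] using Submodule.finrank_le (affineSpan ℝ (convexHull ℝ (range points))).direction
  omega

lemma vertexSet_convexHull_range_points :
    vertexSet (convexHull ℝ (range points)) = range points := by
  ext v
  constructor
  · intro hv
    exact extremePoints_convexHull_subset
      (isExtreme_singleton.1 (IsExposed.isExtreme hv))
  · rintro ⟨k, rfl⟩
    obtain ⟨⟨i, hi⟩, j, hj⟩ := exists_notMem_of_card_le_two {k} (by simp)
    simpa [vertexSet, IsVertex] using isExposed_convexHull_image {k} hi hj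

lemma twoNeighborly_convexHull_range_points :
    TwoNeighborly (convexHull ℝ (range points)) := by
  intro u v hu hv huv
  obtain ⟨a, rfl⟩ := vertexSet_convexHull_range_points.subset hu
  obtain ⟨b, rfl⟩ := vertexSet_convexHull_range_points.subset hv
  have hab : a ≠ b := fun h => huv (congrArg points h)
  obtain ⟨⟨i, hi⟩, j, hj⟩ := exists_notMem_of_card_le_two {a, b} Finset.card_le_two
  have himage : points '' ({a, b} : Finset (Fin 3 ⊕ Fin 3)) = {points a, points b} := by
    simp [image_pair]
  have hdim := pdim_convexHull_points {a, b} (by simp) hi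
  rw [himage, Finset.card_pair hab] at hdim
  exact ⟨himage ▸ isExposed_convexHull_image {a, b} hi hj, by omega⟩

/-- A proper exposed face misses a point on each side of the dependence. -/
lemma exists_notMem_of_isExposed {F : Set (Fin 4 → ℝ)}
    (hF : IsExposed ℝ (convexHull ℝ (range points)) F) (hne : F.Nonempty)
    (hproper : F ≠ convexHull ℝ (range points)) :
    (∃ i, points (.inl i) ∉ F) ∧ ∃ j, points (.inr j) ∉ F := by
  obtain ⟨l, hl⟩ := hF hne
  obtain ⟨x, hx⟩ := hne
  have hmem : ∀ k, points k ∈ convexHull ℝ (range points) := fun k =>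
    subset_convexHull ℝ _ (mem_range_self k)
  have hxF := hx
  rw [hl] at hxF
  have hiff : ∀ k, points k ∈ F ↔ l (points k) = l x := by
    intro k
    refine ⟨fun hk => ?_, fun hk => ?_⟩
    · rw [hl] at hk
      exact le_antisymm (hxF.2 _ (hmem k)) (hk.2 _ hxF.1)
    · rw [hl]
      exact ⟨hmem k, fun y hy => hk ▸ hxF.2 y hy⟩
  have hle : ∀ k, l (points k) ≤ l x := fun k => hxF.2 _ (hmem k)
  have hdep : l (points (.inl 0)) + l (points (.inl 1)) + l (points (.inl 2)) =
      l (points (.inr 0)) + l (points (.inr 1)) + l (points (.inr 2)) := by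
    simp only [← map_add]
    congr 1
    ext k
    fin_cases k <;> simp [points]
  have hall : ¬ ∀ k, points k ∈ F := fun h => hproper
    (subset_antisymm hF.subset (convexHull_min (by rintro _ ⟨k, rfl⟩; exact h k)
      (hF.convex (convex_convexHull ℝ _))))
  have hle' := And.intro (Fin.forall_fin_succ.1 fun i => hle (.inl i))
    (Fin.forall_fin_succ.1 fun i => hle (.inr i))
  simp only [hiff, Sum.forall, Fin.forall_fin_succ] at hall
  simp only [hiff]
  constructor <;> by_contra! h <;> refine hall ?_ <;>
    simp [Fin.forall_fin_succ] at h hle' ⊢ <;>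
    refine ⟨⟨?_, ?_, ?_⟩, ?_, ?_, ?_⟩ <;> linarith

/-- The facet obtained by removing one point on each side of the dependence. -/
def pointsFacet (a : Fin 3 × Fin 3) : Set (Fin 4 → ℝ) :=
  convexHull ℝ (points '' (({.inl a.1, .inr a.2}ᶜ : Finset (Fin 3 ⊕ Fin 3)) :
    Set (Fin 3 ⊕ Fin 3)))

lemma card_compl_inl_inr (i j : Fin 3) :
    ({.inl i, .inr j}ᶜ : Finset (Fin 3 ⊕ Fin 3)).card = 4 := by
  rw [Finset.card_compl, Finset.card_pair (by simp)]
  simp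

lemma pointsFacet_injective : Function.Injective pointsFacet := by
  rintro ⟨i, j⟩ ⟨i', j'⟩ h
  have key : ∀ k : Fin 3 ⊕ Fin 3,
      k ∈ ({.inl i, .inr j}ᶜ : Finset (Fin 3 ⊕ Fin 3)) ↔
      k ∈ ({.inl i', .inr j'}ᶜ : Finset (Fin 3 ⊕ Fin 3)) := by
    intro k
    rw [← points_mem_convexHull_image_iff _ (i := i) (j := j) (by simp) (by simp) k,
      ← points_mem_convexHull_image_iff _ (i := i') (j := j') (by simp) (by simp) k]
    exact iff_of_eq (congrArg (points k ∈ ·) h)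
  have h₁ := key (.inl i)
  have h₂ := key (.inr j)
  simp at h₁ h₂
  rw [h₁, h₂]

lemma facetSet_convexHull_range_points :
    facetSet (convexHull ℝ (range points)) = range pointsFacet := by
  classical
  ext F
  constructor
  · rintro ⟨hF, hne, hdim⟩
    obtain ⟨⟨i, hi⟩, j, hj⟩ := exists_notMem_of_isExposed hF hne (by rintro rfl; omega)
    let K : Finset (Fin 3 ⊕ Fin 3) := {k | points k ∈ F}
    have hFK : F = convexHull ℝ (points '' K) := by
      have hK : points '' K = range points ∩ F := by
        ext x; simp only [K, Finset.coe_filter, mem_image]; aesop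
      rw [hK]
      exact eq_convexHull_inter_of_isExposed (finite_range points) hF
    have hKne : K.Nonempty := by
      rw [hFK, convexHull_nonempty_iff, image_nonempty] at hne
      exact_mod_cast hne
    have hcard := pdim_convexHull_points K hKne (k₀ := .inl i) (by simpa [K] using hi)
    rw [← hFK, hdim, pdim_convexHull_range_points] at hcard
    have hKeq : K = {.inl i, .inr j}ᶜ := by
      refine Finset.eq_of_subset_of_card_le (fun k hk => ?_) ?_
      · simp only [Finset.mem_compl, Finset.mem_insert, Finset.mem_singleton]
        rintro (rfl | rfl)
        · exact hi (by simpa [K] using hk)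
        · exact hj (by simpa [K] using hk)
      · rw [card_compl_inl_inr, hcard]
    exact ⟨(i, j), by rw [hFK, hKeq, pointsFacet]⟩
  · rintro ⟨⟨i, j⟩, rfl⟩
    have hKne : ({.inl i, .inr j}ᶜ : Finset (Fin 3 ⊕ Fin 3)).Nonempty := by
      rw [← Finset.card_pos, card_compl_inl_inr]; norm_num
    refine ⟨isExposed_convexHull_image _ (i := i) (j := j) (by simp) (by simp), ?_, ?_⟩
    · rw [pointsFacet, convexHull_nonempty_iff, image_nonempty]
      exact_mod_cast hKne
    · rw [pointsFacet, pdim_convexHull_points _ hKne (k₀ := .inl i) (by simp),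
        card_compl_inl_inr, pdim_convexHull_range_points]

/-- The convex hull `P` of the six listed points in `ℝ^4` is a 4-polytope whose
vertex set is exactly this set of points, `P` is 2-neighborly, and `P` has exactly 9 facets. -/
theorem P469_two_neighborly :
    ∀ S : Set (Fin 4 → ℝ), S = {![0,0,0,0], ![0,0,0,1], ![0,0,1,0],
        ![0,1,0,0], ![1,0,0,1], ![1,1,1,0]} →
    ∀ P : Set (Fin 4 → ℝ), P = convexHull ℝ S →
      IsPolytope P ∧ pdim P = 4 ∧ vertexSet P = S ∧ TwoNeighborly P ∧
      (facetSet P).ncard = 9 := by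
  intro S hS P hP
  have hrange : S = range points := by
    rw [hS]
    ext x
    simp only [mem_range, Sum.exists, Fin.exists_fin_succ, points]
    simp [eq_comm]
    tauto
  subst hP
  rw [hrange]
  refine ⟨⟨(finite_range points).toFinset, by simp⟩, pdim_convexHull_range_points,
    vertexSet_convexHull_range_points, twoNeighborly_convexHull_range_points, ?_⟩
  rw [facetSet_convexHull_range_points, ← image_univ,
    ncard_image_of_injective _ pointsFacet_injective, ncard_univ]
  simp
end

section
/- Let S ⊂ ℝ^5 be the set of eight points (0,0,0,0,0), (0,0,0,0,1), (0,0,0,1,0), (0,0,1,0,0), (0,1,0,0,1), (0,1,1,1,0), (1,0,0,1,0), (1,0,1,0,1), and let P be the convex hull of S. Then P is a 5-polytope whose vertex set is exactly S, P is 2-neighborly, and P has exactly 12 facets. -/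
open Set

open Module

section General

variable {E ι : Type*} [AddCommGroup E] [Module ℝ E] [TopologicalSpace E]

/-- A face of the convex hull of a family of points, exposed by a functional `l`, is the convex
hull of those points of the family at which `l` is maximal. -/
lemma exposedFace_convexHull_range (V : ι → E) (l : E →L[ℝ] ℝ) (M : ℝ)
    (hle : ∀ i, l (V i) ≤ M) (hM : ∃ i, l (V i) = M) :
    {x ∈ convexHull ℝ (range V) | ∀ y ∈ convexHull ℝ (range V), l y ≤ l x} =
      convexHull ℝ (V '' {i | l (V i) = M}) := by
  set C := convexHull ℝ (V '' {i | l (V i) = M}) with hC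
  have hT : Convex ℝ {x : E | l x ≤ M ∧ (l x = M → x ∈ C)} := by
    intro x hx y hy a b ha hb hab
    obtain ⟨hx1, hx2⟩ := hx
    obtain ⟨hy1, hy2⟩ := hy
    have hl : l (a • x + b • y) = a * l x + b * l y := by simp
    refine ⟨?_, fun h => ?_⟩
    · have hM' : a * M + b * M = M := by rw [← add_mul, hab, one_mul]
      rw [hl, ← hM']
      gcongr
    · rw [hl] at h
      rcases ha.eq_or_lt with rfl | ha'
      · obtain rfl : b = 1 := by linarith
        simpa using hy2 (by linarith)
      rcases hb.eq_or_lt with rfl | hb'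
      · obtain rfl : a = 1 := by linarith
        simpa using hx2 (by linarith)
      have h1 : a * (M - l x) + b * (M - l y) = 0 := by linear_combination M * hab - h
      have h2 := mul_nonneg ha (sub_nonneg.2 hx1)
      have h3 := mul_nonneg hb (sub_nonneg.2 hy1)
      have h4 : a * (M - l x) = 0 := by linarith
      have h5 : b * (M - l y) = 0 := by linarith
      have h6 := (mul_eq_zero.1 h4).resolve_left ha'.ne'
      have h7 := (mul_eq_zero.1 h5).resolve_left hb'.ne'
      exact convex_convexHull ℝ _ (hx2 (by linarith)) (hy2 (by linarith)) ha hb hab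
  have hsub : convexHull ℝ (range V) ⊆ {x : E | l x ≤ M ∧ (l x = M → x ∈ C)} := by
    refine convexHull_min ?_ hT
    rintro _ ⟨i, rfl⟩
    exact ⟨hle i, fun h => subset_convexHull ℝ _ ⟨i, h, rfl⟩⟩
  have hCM : C ⊆ {x : E | l x = M} := by
    refine convexHull_min ?_ (convex_hyperplane l.toLinearMap.isLinear M)
    rintro _ ⟨i, hi, rfl⟩
    exact hi
  apply Subset.antisymm
  · rintro x ⟨hx, hmax⟩
    obtain ⟨i, hi⟩ := hM
    refine (hsub hx).2 (le_antisymm (hsub hx).1 ?_)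
    rw [← hi]
    exact hmax _ (subset_convexHull ℝ _ ⟨i, rfl⟩)
  · intro x hx
    refine ⟨convexHull_mono (image_subset_range _ _) hx, fun y hy => ?_⟩
    rw [hCM hx]
    exact (hsub hy).1

lemma isExposed_convexHull_image_s17 (V : ι → E) (l : E →L[ℝ] ℝ) (M : ℝ)
    (hle : ∀ i, l (V i) ≤ M) (hM : ∃ i, l (V i) = M) :
    IsExposed ℝ (convexHull ℝ (range V)) (convexHull ℝ (V '' {i | l (V i) = M})) :=
  fun _ => ⟨l, (exposedFace_convexHull_range V l M hle hM).symm⟩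

lemma IsExposed.exists_eq_convexHull_image [Finite ι] [Nonempty ι] {V : ι → E} {F : Set E}
    (hF : IsExposed ℝ (convexHull ℝ (range V)) F) (hne : F.Nonempty) :
    ∃ (l : E →L[ℝ] ℝ) (M : ℝ), (∀ i, l (V i) ≤ M) ∧ (∃ i, l (V i) = M) ∧
      F = convexHull ℝ (V '' {i | l (V i) = M}) := by
  obtain ⟨l, hl⟩ := hF hne
  obtain ⟨i, hi⟩ := Finite.exists_max fun i => l (V i)
  exact ⟨l, l (V i), hi, ⟨i, rfl⟩,
    hl.trans (exposedFace_convexHull_range V l _ hi ⟨i, rfl⟩)⟩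

lemma mem_convexHull_image_iff (V : ι → E) (l : E →L[ℝ] ℝ) (M : ℝ) (i : ι) :
    V i ∈ convexHull ℝ (V '' {i | l (V i) = M}) ↔ l (V i) = M := by
  refine ⟨fun h => ?_, fun h => subset_convexHull ℝ _ ⟨i, h, rfl⟩⟩
  refine convexHull_min (t := {x : E | l x = M}) ?_
    (convex_hyperplane l.toLinearMap.isLinear M) h
  rintro _ ⟨j, hj, rfl⟩
  exact hj

end General

lemma pdim_convexHull {N : ℕ} (s : Set (Fin N → ℝ)) :
    pdim (convexHull ℝ s) = finrank ℝ (vectorSpan ℝ s) := by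
  rw [pdim, affineSpan_convexHull, direction_affineSpan]

lemma mem_dualAnnihilator_vectorSpan_iff {E : Type*} [AddCommGroup E] [Module ℝ E] {s : Set E}
    {f : Dual ℝ E} :
    f ∈ (vectorSpan ℝ s).dualAnnihilator ↔ ∀ x ∈ s, ∀ y ∈ s, f x = f y := by
  rw [Submodule.mem_dualAnnihilator]
  refine ⟨fun h x hx y hy => ?_, fun h w hw => ?_⟩
  · have := h _ (vsub_mem_vectorSpan ℝ hx hy)
    rw [vsub_eq_sub, map_sub] at this
    linarith
  · have hle : vectorSpan ℝ s ≤ LinearMap.ker f := by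
      refine Submodule.span_le.2 ?_
      rintro _ ⟨x, hx, y, hy, rfl⟩
      simp [h x hx y hy]
    exact hle hw

/-- The integral coordinates of the eight points. -/
def vertexCoord : Fin 8 → Fin 5 → ℤ :=
  ![![0,0,0,0,0], ![0,0,0,0,1], ![0,0,0,1,0], ![0,0,1,0,0],
    ![0,1,0,0,1], ![0,1,1,1,0], ![1,0,0,1,0], ![1,0,1,0,1]]

/-- The eight points in `ℝ^5`. -/
def vertexPoint (i : Fin 8) : Fin 5 → ℝ := fun j => (vertexCoord i j : ℝ)

/-- The outer normals of the twelve facets. -/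
def facetNormal : Fin 12 → Fin 5 → ℤ :=
  ![![-1,0,0,0,0], ![0,-1,0,0,0], ![0,0,-1,0,0], ![0,0,0,-1,0],
    ![1,0,-1,-1,0], ![0,0,0,0,-1], ![0,1,-1,0,-1], ![1,1,0,-1,-1],
    ![-1,-1,1,1,1], ![0,0,0,1,1], ![-1,0,1,0,1], ![0,-1,1,1,0]]

/-- The right-hand sides of the facet inequalities. -/
def facetBound : Fin 12 → ℤ := ![0,0,0,0,0,0,0,0,1,1,1,1]

/-- The linear functional on `ℝ^5` with the given integral coefficients. -/
noncomputable def intFunctional (c : Fin 5 → ℤ) : (Fin 5 → ℝ) →L[ℝ] ℝ :=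
  ∑ j, (c j : ℝ) • ContinuousLinearMap.proj j

lemma intFunctional_apply (c : Fin 5 → ℤ) (x : Fin 5 → ℝ) :
    intFunctional c x = ∑ j, (c j : ℝ) * x j := by
  simp [intFunctional]

lemma intFunctional_vertexPoint (c : Fin 5 → ℤ) (i : Fin 8) :
    intFunctional c (vertexPoint i) = ((c ⬝ᵥ vertexCoord i : ℤ) : ℝ) := by
  simp [intFunctional_apply, vertexPoint, dotProduct]

lemma range_vertexPoint : range vertexPoint =
    {![0,0,0,0,0], ![0,0,0,0,1], ![0,0,0,1,0], ![0,0,1,0,0],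
      ![0,1,0,0,1], ![0,1,1,1,0], ![1,0,0,1,0], ![1,0,1,0,1]} := by
  have h : vertexPoint = ![![0,0,0,0,0], ![0,0,0,0,1], ![0,0,0,1,0], ![0,0,1,0,0],
      ![0,1,0,0,1], ![0,1,1,1,0], ![1,0,0,1,0], ![1,0,1,0,1]] := by
    ext i j
    fin_cases i <;> fin_cases j <;> simp [vertexPoint, vertexCoord]
  rw [h]
  simp only [Matrix.range_cons, Matrix.range_empty, union_empty, singleton_union]

lemma map_vertexPoint (f : Dual ℝ (Fin 5 → ℝ)) (i : Fin 8) :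
    f (vertexPoint i) = ∑ j, (vertexCoord i j : ℝ) * f (Pi.single j 1) := by
  rw [LinearMap.pi_apply_eq_sum_univ f]
  refine Finset.sum_congr rfl fun j _ => ?_
  rw [smul_eq_mul, vertexPoint]
  congr 2
  ext m
  simp [Pi.single_apply, eq_comm]

lemma map_vertexPoint_eq (f : Dual ℝ (Fin 5 → ℝ)) (i : Fin 8) :
    f (vertexPoint i) = (![0, f (Pi.single 4 1), f (Pi.single 3 1), f (Pi.single 2 1),
      f (Pi.single 1 1) + f (Pi.single 4 1),
      f (Pi.single 1 1) + f (Pi.single 2 1) + f (Pi.single 3 1),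
      f (Pi.single 0 1) + f (Pi.single 3 1),
      f (Pi.single 0 1) + f (Pi.single 2 1) + f (Pi.single 4 1)] : Fin 8 → ℝ) i := by
  rw [map_vertexPoint]
  fin_cases i <;> simp [vertexCoord, Fin.sum_univ_five]

lemma facetNormal_dotProduct_le (k : Fin 12) (i : Fin 8) :
    facetNormal k ⬝ᵥ vertexCoord i ≤ facetBound k := by
  revert k i
  decide +kernel

/-- The set of indices of the points lying on the `k`-th facet. -/
def facetIndices (k : Fin 12) : Set (Fin 8) :=
  {i | facetNormal k ⬝ᵥ vertexCoord i = facetBound k}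

instance (k : Fin 12) (i : Fin 8) : Decidable (i ∈ facetIndices k) :=
  inferInstanceAs (Decidable (_ = _))

lemma mem_facetIndices_iff (k : Fin 12) (i : Fin 8) :
    i ∈ facetIndices k ↔ i ∈ (![{0, 1, 2, 3, 4, 5}, {0, 1, 2, 3, 6, 7}, {0, 1, 2, 4, 6},
      {0, 1, 3, 4, 7}, {0, 1, 4, 6, 7}, {0, 2, 3, 5, 6}, {0, 2, 4, 5, 6}, {0, 3, 4, 5, 6, 7},
      {1, 2, 3, 5, 7}, {1, 2, 4, 5, 6, 7}, {1, 3, 4, 5, 7}, {2, 3, 5, 6, 7}] :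
        Fin 12 → Finset (Fin 8)) k := by
  revert k i
  decide +kernel

lemma facetIndices_injective : Function.Injective facetIndices := by
  have h : ∀ k k' : Fin 12, (∀ i, i ∈ facetIndices k ↔ i ∈ facetIndices k') → k = k' := by
    decide +kernel
  exact fun k k' hk => h k k' fun i => by rw [hk]

lemma facetIndices_nonempty (k : Fin 12) : (facetIndices k).Nonempty := by
  have h : ∀ k, ∃ i, i ∈ facetIndices k := by decide +kernel
  exact h k

lemma facetIndices_eq (k : Fin 12) :
    facetIndices k =
      {i | intFunctional (facetNormal k) (vertexPoint i) = (facetBound k : ℝ)} := by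
  ext i
  simp only [facetIndices, mem_ofPred_eq, intFunctional_vertexPoint, Int.cast_inj]

lemma isExposed_facet (k : Fin 12) :
    IsExposed ℝ (convexHull ℝ (range vertexPoint))
      (convexHull ℝ (vertexPoint '' facetIndices k)) := by
  have hne := facetIndices_nonempty k
  rw [facetIndices_eq]
  refine isExposed_convexHull_image_s17 _ _ _ (fun i => ?_) ?_
  · rw [intFunctional_vertexPoint, Int.cast_le]
    exact facetNormal_dotProduct_le k i
  · rw [facetIndices_eq] at hne
    exact hne

/-- The sum of the outer normals of all facets containing both the `i`-th and the `j`-th point. -/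
def edgeNormal (i j : Fin 8) : Fin 5 → ℤ :=
  ∑ k with i ∈ facetIndices k ∧ j ∈ facetIndices k, facetNormal k

lemma edgeNormal_spec (i j m : Fin 8) :
    edgeNormal i j ⬝ᵥ vertexCoord m ≤ edgeNormal i j ⬝ᵥ vertexCoord i ∧
      (edgeNormal i j ⬝ᵥ vertexCoord m = edgeNormal i j ⬝ᵥ vertexCoord i ↔ m = i ∨ m = j) := by
  revert i j m
  decide +kernel

lemma isExposed_pair (i j : Fin 8) :
    IsExposed ℝ (convexHull ℝ (range vertexPoint))
      (convexHull ℝ {vertexPoint i, vertexPoint j}) := by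
  have h : {m | intFunctional (edgeNormal i j) (vertexPoint m) =
      intFunctional (edgeNormal i j) (vertexPoint i)} = {i, j} := by
    ext m
    simp only [intFunctional_vertexPoint, Int.cast_inj, mem_ofPred_eq, mem_insert_iff,
      mem_singleton_iff]
    exact (edgeNormal_spec i j m).2
  rw [← image_pair, ← h]
  refine isExposed_convexHull_image_s17 _ _ _ (fun m => ?_) ⟨i, rfl⟩
  rw [intFunctional_vertexPoint, intFunctional_vertexPoint, Int.cast_le]
  exact (edgeNormal_spec i j m).1

lemma vertexSet_convexHull_range_vertexPoint :
    vertexSet (convexHull ℝ (range vertexPoint)) = range vertexPoint := by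
  ext v
  constructor
  · intro hv
    obtain ⟨l, M, -, ⟨i, hi⟩, h⟩ :=
      IsExposed.exists_eq_convexHull_image (V := vertexPoint) hv (singleton_nonempty v)
    have : vertexPoint i ∈ ({v} : Set (Fin 5 → ℝ)) := by
      rw [h]
      exact subset_convexHull ℝ _ ⟨i, hi, rfl⟩
    exact ⟨i, this⟩
  · rintro ⟨i, rfl⟩
    simpa [vertexSet, IsVertex] using isExposed_pair i i

lemma pdim_convexHull_pair {N : ℕ} {u v : Fin N → ℝ} (h : u ≠ v) :
    pdim (convexHull ℝ ({u, v} : Set (Fin N → ℝ))) = 1 := by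
  rw [pdim_convexHull, vectorSpan_pair, finrank_span_singleton]
  simpa [sub_eq_zero] using h

lemma twoNeighborly_convexHull_range_vertexPoint :
    TwoNeighborly (convexHull ℝ (range vertexPoint)) := by
  intro u v hu hv huv
  have hu' : u ∈ range vertexPoint := vertexSet_convexHull_range_vertexPoint ▸ hu
  have hv' : v ∈ range vertexPoint := vertexSet_convexHull_range_vertexPoint ▸ hv
  obtain ⟨i, rfl⟩ := hu'
  obtain ⟨j, rfl⟩ := hv'
  exact ⟨isExposed_pair i j, pdim_convexHull_pair huv⟩

lemma finrank_add_finrank_dualAnnihilator_eq_five (W : Submodule ℝ (Fin 5 → ℝ)) :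
    finrank ℝ W + finrank ℝ W.dualAnnihilator = 5 := by
  simpa using Subspace.finrank_add_finrank_dualAnnihilator_eq W

lemma pdim_convexHull_range_vertexPoint : pdim (convexHull ℝ (range vertexPoint)) = 5 := by
  rw [pdim_convexHull]
  have h := finrank_add_finrank_dualAnnihilator_eq_five (vectorSpan ℝ (range vertexPoint))
  have h0 : (vectorSpan ℝ (range vertexPoint)).dualAnnihilator = ⊥ := by
    rw [eq_bot_iff]
    intro f hf
    rw [mem_dualAnnihilator_vectorSpan_iff] at hf
    have hf' : ∀ i, f (vertexPoint i) = f (vertexPoint 0) :=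
      fun i => hf _ ⟨i, rfl⟩ _ ⟨0, rfl⟩
    simp [Fin.forall_fin_succ, map_vertexPoint_eq] at hf'
    rw [Submodule.mem_bot]
    refine LinearMap.pi_ext' fun j => LinearMap.ext_ring ?_
    fin_cases j <;> simp <;> linarith
  rw [h0, finrank_bot] at h
  exact h

lemma exists_facetNormal_mul_self_eq_one (k : Fin 12) :
    ∃ j, facetNormal k j * facetNormal k j = 1 := by
  revert k
  decide +kernel

lemma dualAnnihilator_facet (k : Fin 12) :
    (vectorSpan ℝ (vertexPoint '' facetIndices k)).dualAnnihilator =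
      ℝ ∙ (intFunctional (facetNormal k) : Dual ℝ (Fin 5 → ℝ)) := by
  apply le_antisymm
  · intro f hf
    rw [mem_dualAnnihilator_vectorSpan_iff] at hf
    obtain ⟨i₀, hi₀⟩ := facetIndices_nonempty k
    have hc : ∀ i ∈ facetIndices k, f (vertexPoint i) = f (vertexPoint i₀) :=
      fun i hi => hf _ ⟨i, hi, rfl⟩ _ ⟨i₀, hi₀, rfl⟩
    generalize f (vertexPoint i₀) = c at hc
    clear hi₀ hf
    simp only [mem_facetIndices_iff, map_vertexPoint_eq] at hc
    rw [Submodule.mem_span_singleton]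
    let p : Fin 5 := (![0, 1, 2, 3, 0, 4, 1, 0, 0, 3, 0, 1] : Fin 12 → Fin 5) k
    refine ⟨f (Pi.single p 1) * facetNormal k p, ?_⟩
    refine LinearMap.pi_ext' fun m => LinearMap.ext_ring ?_
    suffices f (Pi.single p 1) * facetNormal k p * facetNormal k m = f (Pi.single m 1) by
      simpa [intFunctional_apply, Pi.single_apply] using this
    subst p
    fin_cases k <;> simp at hc <;> fin_cases m <;> simp [facetNormal] <;> linarith
  · rw [Submodule.span_singleton_le_iff_mem, mem_dualAnnihilator_vectorSpan_iff]
    rw [facetIndices_eq]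
    rintro _ ⟨i, hi, rfl⟩ _ ⟨j, hj, rfl⟩
    exact hi.trans hj.symm

lemma pdim_facet (k : Fin 12) : pdim (convexHull ℝ (vertexPoint '' facetIndices k)) = 4 := by
  have h := finrank_add_finrank_dualAnnihilator_eq_five
    (vectorSpan ℝ (vertexPoint '' facetIndices k))
  rw [dualAnnihilator_facet, finrank_span_singleton] at h
  · rw [pdim_convexHull]
    omega
  · intro h0
    obtain ⟨j, hj⟩ := exists_facetNormal_mul_self_eq_one k
    have := LinearMap.congr_fun h0 (Pi.single j 1)
    simp [intFunctional_apply, Pi.single_apply] at this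
    simp [this] at hj

/-- Every proper face lies in one of the twelve facets. -/
lemma exists_subset_facetIndices (f : Dual ℝ (Fin 5 → ℝ)) (M : ℝ)
    (hle : ∀ i, f (vertexPoint i) ≤ M) (hne : ∃ i, f (vertexPoint i) ≠ M) :
    ∃ k, {i | f (vertexPoint i) = M} ⊆ facetIndices k := by
  classical
  have hcover : ∀ I : Finset (Fin 8),
      (0 ∈ I ∧ 1 ∈ I ∧ 5 ∈ I ↔ 2 ∈ I ∧ 3 ∈ I ∧ 4 ∈ I) →
      (0 ∈ I ∧ 2 ∈ I ∧ 7 ∈ I ↔ 1 ∈ I ∧ 3 ∈ I ∧ 6 ∈ I) →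
      (0 ∈ I ∧ 5 ∈ I ∧ 7 ∈ I ↔ 3 ∈ I ∧ 4 ∈ I ∧ 6 ∈ I) →
      (1 ∈ I ∧ 5 ∈ I ∧ 6 ∈ I ↔ 2 ∈ I ∧ 4 ∈ I ∧ 7 ∈ I) →
      (∃ i, i ∉ I) → ∃ k, ∀ i ∈ I, i ∈ facetIndices k := by
    decide +kernel
  have h1 : f (vertexPoint 0) + f (vertexPoint 1) + f (vertexPoint 5) =
      f (vertexPoint 2) + f (vertexPoint 3) + f (vertexPoint 4) := by
    simp [map_vertexPoint_eq]
    ring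
  have h2 : f (vertexPoint 0) + f (vertexPoint 2) + f (vertexPoint 7) =
      f (vertexPoint 1) + f (vertexPoint 3) + f (vertexPoint 6) := by
    simp [map_vertexPoint_eq]
    ring
  have hle0 := hle 0
  have hle1 := hle 1
  have hle2 := hle 2
  have hle3 := hle 3
  have hle4 := hle 4
  have hle5 := hle 5
  have hle6 := hle 6
  have hle7 := hle 7
  have hI : ∀ i, i ∈ Finset.univ.filter (fun i => f (vertexPoint i) = M) ↔
      f (vertexPoint i) = M := by simp
  obtain ⟨k, hk⟩ := hcover (Finset.univ.filter fun i => f (vertexPoint i) = M)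
    (by
      simp only [hI]
      constructor <;> rintro ⟨_, _, _⟩ <;> refine ⟨?_, ?_, ?_⟩ <;> linarith)
    (by
      simp only [hI]
      constructor <;> rintro ⟨_, _, _⟩ <;> refine ⟨?_, ?_, ?_⟩ <;> linarith)
    (by
      simp only [hI]
      constructor <;> rintro ⟨_, _, _⟩ <;> refine ⟨?_, ?_, ?_⟩ <;> linarith)
    (by
      simp only [hI]
      constructor <;> rintro ⟨_, _, _⟩ <;> refine ⟨?_, ?_, ?_⟩ <;> linarith)
    (by simpa only [hI] using hne)
  exact ⟨k, fun i hi => hk i ((hI i).2 hi)⟩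

lemma facetSet_convexHull_range_vertexPoint :
    facetSet (convexHull ℝ (range vertexPoint)) =
      range fun k => convexHull ℝ (vertexPoint '' facetIndices k) := by
  ext F
  constructor
  · rintro ⟨hF, hne, hdim⟩
    rw [pdim_convexHull_range_vertexPoint] at hdim
    obtain ⟨l, M, hle, ⟨i, hi⟩, rfl⟩ :=
      IsExposed.exists_eq_convexHull_image (V := vertexPoint) hF hne
    have hproper : ∃ i, l (vertexPoint i) ≠ M := by
      by_contra! h
      have : {i | l (vertexPoint i) = M} = univ := eq_univ_of_forall h
      rw [this, image_univ, pdim_convexHull_range_vertexPoint] at hdim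
      omega
    obtain ⟨k, hk⟩ := exists_subset_facetIndices l M hle hproper
    refine ⟨k, ?_⟩
    have hk' : {i | l (vertexPoint i) = M} ⊆ facetIndices k := hk
    suffices h : facetIndices k = {i | l (vertexPoint i) = M} by simp only [h]
    refine Subset.antisymm (fun j hj => ?_) hk'
    have hspan : vectorSpan ℝ (vertexPoint '' {i | l (vertexPoint i) = M}) =
        vectorSpan ℝ (vertexPoint '' facetIndices k) := by
      refine Submodule.eq_of_le_of_finrank_eq (vectorSpan_mono ℝ (image_mono hk')) ?_
      rw [← pdim_convexHull, ← pdim_convexHull, pdim_facet]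
      omega
    have hl : (l : Dual ℝ (Fin 5 → ℝ)) ∈
        (vectorSpan ℝ (vertexPoint '' facetIndices k)).dualAnnihilator := by
      rw [← hspan, mem_dualAnnihilator_vectorSpan_iff]
      rintro _ ⟨i, hi, rfl⟩ _ ⟨j, hj, rfl⟩
      exact hi.trans hj.symm
    rw [mem_dualAnnihilator_vectorSpan_iff] at hl
    exact (hl _ ⟨j, hj, rfl⟩ _ ⟨i, hk' hi, rfl⟩).trans hi
  · rintro ⟨k, rfl⟩
    have hdim := pdim_facet k
    refine ⟨isExposed_facet k, ?_, ?_⟩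
    · exact ((facetIndices_nonempty k).image _).convexHull
    · rw [pdim_convexHull_range_vertexPoint]
      simp only [hdim]

lemma facet_injective :
    Function.Injective fun k => convexHull ℝ (vertexPoint '' facetIndices k) := by
  intro k k' h
  apply facetIndices_injective
  ext i
  have h' := Set.ext_iff.1 h (vertexPoint i)
  simp only [facetIndices_eq, mem_convexHull_image_iff] at h' ⊢
  exact h'

/-- The convex hull `P` of the eight listed points in `ℝ^5` is a 5-polytope whose
vertex set is exactly this set of points, `P` is 2-neighborly, and `P` has exactly 12 facets. -/
theorem P5812_two_neighborly :
    ∀ S : Set (Fin 5 → ℝ), S = {![0,0,0,0,0], ![0,0,0,0,1], ![0,0,0,1,0], ![0,0,1,0,0],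
        ![0,1,0,0,1], ![0,1,1,1,0], ![1,0,0,1,0], ![1,0,1,0,1]} →
    ∀ P : Set (Fin 5 → ℝ), P = convexHull ℝ S →
      IsPolytope P ∧ pdim P = 5 ∧ vertexSet P = S ∧ TwoNeighborly P ∧
      (facetSet P).ncard = 12 := by
  rintro S hS P rfl
  rw [← range_vertexPoint] at hS
  subst hS
  refine ⟨⟨(finite_range vertexPoint).toFinset, by simp⟩, pdim_convexHull_range_vertexPoint,
    vertexSet_convexHull_range_vertexPoint, twoNeighborly_convexHull_range_vertexPoint, ?_⟩
  rw [facetSet_convexHull_range_vertexPoint, ← image_univ,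
    ncard_image_of_injective _ facet_injective, ncard_univ, Nat.card_fin]
end

section
/- Let S ⊂ ℝ^6 be the set of ten points (1,1,1,1,1,0), (1,1,1,1,−1,0), (1,1,1,−1,1,0), (1,1,−1,1,1,0), (1,−1,1,1,−1,0), (1,−1,−1,−1,1,0), (−1,1,1,−1,1,0), (−1,1,−1,1,−1,0), (0,0,1,1,0,1), (0,0,−1,0,1,1), and let P be the convex hull of S. Then P is a 6-polytope whose vertex set is exactly S, P is 2-neighborly, and P has exactly 15 facets. -/
open Set

namespace TenPointPolytope

/-! ### Linear functionals and faces of convex hulls -/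

section General

/-- The continuous linear functional on `ℝ^N` with the given coefficients. -/
noncomputable def functional {N : ℕ} (c : Fin N → ℝ) : StrongDual ℝ (Fin N → ℝ) :=
  ∑ j, c j • ContinuousLinearMap.proj j

theorem functional_apply {N : ℕ} (c x : Fin N → ℝ) : functional c x = ∑ j, c j * x j := by
  simp [functional]

theorem linearMap_eq_functional {N : ℕ} (f : (Fin N → ℝ) →ₗ[ℝ] ℝ) :
    f = (functional fun j => f (Pi.single j 1) : (Fin N → ℝ) →ₗ[ℝ] ℝ) := by
  ext j
  simp [functional_apply, Pi.single_apply]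

variable {ι E : Type*} [AddCommGroup E] [Module ℝ E]

/-- If a linear functional is at most `M` on a finite family, then any point of the convex hull
where it equals `M` lies in the convex hull of those members of the family where it equals `M`. -/
theorem convexHull_range_inter_level (p : ι → E) (l : E →ₗ[ℝ] ℝ) (M : ℝ)
    (h : ∀ i, l (p i) ≤ M) :
    {x ∈ convexHull ℝ (range p) | l x = M} = convexHull ℝ (p '' {i | l (p i) = M}) := by
  classical
  apply Subset.antisymm
  · rintro x ⟨hx, hxM⟩
    rw [convexHull_range_eq_exists_affineCombination] at hx
    obtain ⟨s, w, hw0, hw1, rfl⟩ := hx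
    rw [Finset.affineCombination_eq_linear_combination _ _ _ hw1] at hxM ⊢
    rw [map_sum] at hxM
    have hsum : ∑ i ∈ s, w i * (M - l (p i)) = 0 := by
      simp only [map_smul, smul_eq_mul] at hxM
      simp only [mul_sub, Finset.sum_sub_distrib, ← Finset.sum_mul, hw1, hxM]
      ring
    rw [Finset.sum_eq_zero_iff_of_nonneg
      fun i hi => mul_nonneg (hw0 i hi) (sub_nonneg.2 (h i))] at hsum
    have hsupp : ∀ i ∈ s, w i ≠ 0 → l (p i) = M := fun i hi hwi => by
      rcases mul_eq_zero.1 (hsum i hi) with h0 | h0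
      · exact absurd h0 hwi
      · linarith
    rw [← Finset.sum_filter_of_ne (p := fun i => l (p i) = M)
      fun i hi hne => hsupp i hi fun h0 => hne (by simp [h0])]
    refine (convex_convexHull ℝ _).sum_mem (fun i hi => hw0 i (Finset.mem_filter.1 hi).1) ?_
      fun i hi => subset_convexHull ℝ _ ⟨i, (Finset.mem_filter.1 hi).2, rfl⟩
    rw [Finset.sum_filter_of_ne fun i hi hne => hsupp i hi hne, hw1]
  · have hconv : Convex ℝ {x ∈ convexHull ℝ (range p) | l x = M} :=
      (convex_convexHull ℝ _).inter (convex_hyperplane l.isLinear M)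
    refine convexHull_min ?_ hconv
    rintro _ ⟨i, hi, rfl⟩
    exact ⟨subset_convexHull ℝ _ ⟨i, rfl⟩, hi⟩

theorem le_of_mem_convexHull_range (p : ι → E) (l : E →ₗ[ℝ] ℝ) (M : ℝ)
    (h : ∀ i, l (p i) ≤ M) {x : E} (hx : x ∈ convexHull ℝ (range p)) : l x ≤ M := by
  refine convexHull_min ?_ (convex_halfSpace_le l.isLinear M) hx
  rintro _ ⟨i, rfl⟩
  exact h i

theorem isExposed_level [TopologicalSpace E] {A : Set E} (l : StrongDual ℝ E) (M : ℝ)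
    (h : ∀ x ∈ A, l x ≤ M) : IsExposed ℝ A {x ∈ A | l x = M} := by
  rintro ⟨x₀, hx₀, hx₀M⟩
  refine ⟨l, Subset.antisymm ?_ ?_⟩
  · rintro x ⟨hx, hxM⟩
    exact ⟨hx, fun y hy => hxM ▸ h y hy⟩
  · rintro x ⟨hx, hmax⟩
    exact ⟨hx, le_antisymm (h x hx) (hx₀M ▸ hmax x₀ hx₀)⟩

end General

section Dimension

variable {V : Type*} [AddCommGroup V] [Module ℝ V]

theorem finrank_eq_of_forall_dual_eq_zero [FiniteDimensional ℝ V] (D : Submodule ℝ V)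
    (h : ∀ f : Module.Dual ℝ V, (∀ x ∈ D, f x = 0) → f = 0) :
    Module.finrank ℝ D = Module.finrank ℝ V := by
  have hD : D.dualAnnihilator = ⊥ := by
    rw [eq_bot_iff]
    intro f hf
    exact h f ((Submodule.mem_dualAnnihilator f).1 hf)
  have := Subspace.finrank_add_finrank_dualAnnihilator_eq D
  rw [hD, finrank_bot] at this
  exact this

theorem finrank_add_one_of_forall_dual [FiniteDimensional ℝ V] (D : Submodule ℝ V)
    (a : Module.Dual ℝ V) (ha : a ≠ 0) (haD : ∀ x ∈ D, a x = 0)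
    (h : ∀ f : Module.Dual ℝ V, (∀ x ∈ D, f x = 0) → ∃ t : ℝ, f = t • a) :
    Module.finrank ℝ D + 1 = Module.finrank ℝ V := by
  have hD : D.dualAnnihilator = Submodule.span ℝ {a} := by
    apply le_antisymm
    · intro f hf
      obtain ⟨t, rfl⟩ := h f ((Submodule.mem_dualAnnihilator f).1 hf)
      exact Submodule.smul_mem _ _ (Submodule.mem_span_singleton_self a)
    · rw [Submodule.span_singleton_le_iff_mem, Submodule.mem_dualAnnihilator]
      exact haD
  have := Subspace.finrank_add_finrank_dualAnnihilator_eq D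
  rw [hD, finrank_span_singleton ha] at this
  exact this

theorem pdim_convexHull {N : ℕ} (A : Set (Fin N → ℝ)) :
    pdim (convexHull ℝ A) = Module.finrank ℝ (vectorSpan ℝ A) := by
  rw [pdim, affineSpan_convexHull, direction_affineSpan]

theorem pdim_convexHull_pair {N : ℕ} {u v : Fin N → ℝ} (h : u ≠ v) :
    pdim (convexHull ℝ {u, v}) = 1 := by
  rw [pdim_convexHull, vectorSpan_pair]
  exact finrank_span_singleton (vsub_ne_zero.2 h)

theorem vectorSpan_dual_eq_zero {A : Set V} {f : Module.Dual ℝ V} {b : ℝ}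
    (h : ∀ x ∈ A, f x = b) : ∀ x ∈ vectorSpan ℝ A, f x = 0 := by
  intro x hx
  have hle : vectorSpan ℝ A ≤ LinearMap.ker f := by
    rw [vectorSpan, Submodule.span_le]
    rintro _ ⟨y, hy, z, hz, rfl⟩
    simp [h y hy, h z hz]
  exact hle hx

/-- A set contained in another one of the same dimension has the same affine span. -/
theorem subset_affineSpan_of_pdim_eq {N : ℕ} {A B : Set (Fin N → ℝ)} (hAB : A ⊆ B)
    (hA : A.Nonempty) (h : pdim A = pdim B) : B ⊆ affineSpan ℝ A := by
  have hle : affineSpan ℝ A ≤ affineSpan ℝ B := affineSpan_mono ℝ hAB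
  have hdir : (affineSpan ℝ A).direction = (affineSpan ℝ B).direction :=
    Submodule.eq_of_le_of_finrank_eq (AffineSubspace.direction_le hle) h
  rw [AffineSubspace.eq_of_direction_eq_of_nonempty_of_le hdir
    ((affineSpan_nonempty ℝ).2 hA) hle]
  exact subset_affineSpan ℝ B

end Dimension

/-! ### The ten points and the fifteen facet normals -/

/-- The ten points, with integer coordinates. -/
def point : Fin 10 → Fin 6 → ℤ :=
  ![![1, 1, 1, 1, 1, 0], ![1, 1, 1, 1, -1, 0], ![1, 1, 1, -1, 1, 0], ![1, 1, -1, 1, 1, 0],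
    ![1, -1, 1, 1, -1, 0], ![1, -1, -1, -1, 1, 0], ![-1, 1, 1, -1, 1, 0],
    ![-1, 1, -1, 1, -1, 0], ![0, 0, 1, 1, 0, 1], ![0, 0, -1, 0, 1, 1]]

/-- Outer normal vectors of the fifteen facets. -/
def normal : Fin 15 → Fin 6 → ℤ :=
  ![![0, 0, 0, 0, 0, -1],
    ![1, 0, 0, 0, 0, 1],
    ![0, 1, 0, 0, 0, 1],
    ![0, 0, 1, 0, 0, 0],
    ![0, 0, 0, 1, 0, 0],
    ![-1, 0, 1, 1, 0, -1],
    ![0, 0, 0, 0, 1, 0],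
    ![0, -1, 1, 0, 1, 0],
    ![0, -1, 1, 0, 2, 1],
    ![-1, -1, 0, 1, 1, -1],
    ![1, 1, -1, -1, -1, 1],
    ![0, 0, 0, -1, -1, 1],
    ![1, 0, -1, 0, -1, 1],
    ![1, 0, -1, 1, -1, 2],
    ![0, 1, -1, -1, 0, 0]]

/-- Maxima over the ten points of the functionals given by `normal`. -/
def offset : Fin 15 → ℤ := ![0, 1, 1, 1, 1, 1, 1, 1, 2, 0, 1, 0, 1, 2, 1]

/-- A coordinate in which the normal vector is `1` or `-1`. -/
def pivot : Fin 15 → Fin 6 := ![5, 0, 1, 2, 3, 0, 4, 1, 1, 0, 0, 3, 0, 0, 1]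

/-- The integral pairing of a coefficient vector with one of the ten points. -/
def value (c : Fin 6 → ℤ) (i : Fin 10) : ℤ := ∑ j, c j * point i j

/-- The sum of the normals of the facets containing the points `i` and `i'`. -/
def pairNormal (i i' : Fin 10) : Fin 6 → ℤ := fun j =>
  ∑ k, if value (normal k) i = offset k ∧ value (normal k) i' = offset k then normal k j else 0

theorem value_normal_le : ∀ k i, value (normal k) i ≤ offset k := by decide +kernel

theorem exists_value_normal_eq : ∀ k, ∃ i, value (normal k) i = offset k := by decide +kernel

theorem value_pairNormal_le :
    ∀ i i' m, value (pairNormal i i') m ≤ value (pairNormal i i') i := by decide +kernel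

theorem value_pairNormal_eq_iff :
    ∀ i i' m, value (pairNormal i i') m = value (pairNormal i i') i ↔ m = i ∨ m = i' := by
  decide +kernel

theorem normal_separated :
    ∀ k k', (∀ i, value (normal k) i = offset k ↔ value (normal k') i = offset k') → k = k' := by
  decide +kernel

theorem normal_pivot_sq : ∀ k, normal k (pivot k) * normal k (pivot k) = 1 := by decide +kernel

/-- A set of points that is closed under three affine dependences of the ten points
either is everything or is contained in one of the fifteen facets. -/
theorem closed_subset_facet : ∀ b₀ b₁ b₂ b₃ b₄ b₅ b₆ b₇ b₈ b₉ : Bool,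
    ((b₀ && b₁ && b₅) = (b₂ && b₃ && b₄)) → ((b₁ && b₃ && b₆) = (b₀ && b₂ && b₇)) →
    ((b₀ && b₄ && b₉) = (b₃ && b₅ && b₈)) →
    (∀ i, ![b₀, b₁, b₂, b₃, b₄, b₅, b₆, b₇, b₈, b₉] i = true) ∨
    ∃ k, ∀ i, ![b₀, b₁, b₂, b₃, b₄, b₅, b₆, b₇, b₈, b₉] i = true →
      value (normal k) i = offset k := by
  decide +kernel

/-- The ten points as real vectors. -/
def realPoint (i : Fin 10) : Fin 6 → ℝ := fun j => (point i j : ℝ)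

/-- The real functional with integer coefficients. -/
noncomputable def intFunctional (c : Fin 6 → ℤ) : StrongDual ℝ (Fin 6 → ℝ) :=
  functional fun j => (c j : ℝ)

theorem intFunctional_realPoint (c : Fin 6 → ℤ) (i : Fin 10) :
    intFunctional c (realPoint i) = (value c i : ℝ) := by
  simp [intFunctional, functional_apply, realPoint, value]

theorem range_realPoint : range realPoint =
    {![1,1,1,1,1,0], ![1,1,1,1,-1,0], ![1,1,1,-1,1,0], ![1,1,-1,1,1,0], ![1,-1,1,1,-1,0],
      ![1,-1,-1,-1,1,0], ![-1,1,1,-1,1,0], ![-1,1,-1,1,-1,0], ![0,0,1,1,0,1],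
      ![0,0,-1,0,1,1]} := by
  have h : realPoint = ![![1,1,1,1,1,0], ![1,1,1,1,-1,0], ![1,1,1,-1,1,0], ![1,1,-1,1,1,0],
      ![1,-1,1,1,-1,0], ![1,-1,-1,-1,1,0], ![-1,1,1,-1,1,0], ![-1,1,-1,1,-1,0],
      ![0,0,1,1,0,1], ![0,0,-1,0,1,1]] := by
    ext i j
    fin_cases i <;> fin_cases j <;> simp [realPoint, point]
  rw [h]
  simp only [Matrix.range_cons, Matrix.range_empty, union_empty, singleton_union]

/-- The convex hull of the ten points. -/
def hull : Set (Fin 6 → ℝ) := convexHull ℝ (range realPoint)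

theorem realPoint_mem_hull (i : Fin 10) : realPoint i ∈ hull :=
  subset_convexHull ℝ _ ⟨i, rfl⟩

/-- The face of the hull on which an integral functional attains the value `b`. -/
theorem intFunctional_level (c : Fin 6 → ℤ) (b : ℤ) (h : ∀ i, value c i ≤ b) :
    {x ∈ hull | intFunctional c x = b} = convexHull ℝ (realPoint '' {i | value c i = b}) := by
  have := convexHull_range_inter_level realPoint (intFunctional c).toLinearMap b
    fun i => by simpa [intFunctional_realPoint] using h i
  simpa [intFunctional_realPoint, hull] using this

theorem isExposed_intFunctional_level (c : Fin 6 → ℤ) (b : ℤ) (h : ∀ i, value c i ≤ b) :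
    IsExposed ℝ hull {x ∈ hull | intFunctional c x = b} :=
  isExposed_level _ _ fun _ hx =>
    le_of_mem_convexHull_range realPoint (intFunctional c).toLinearMap b
      (fun i => by simpa [intFunctional_realPoint] using h i) hx

/-! ### Vertices and edges -/

theorem isExposed_pair (i i' : Fin 10) :
    IsExposed ℝ hull (convexHull ℝ {realPoint i, realPoint i'}) := by
  have hset : {m | value (pairNormal i i') m = value (pairNormal i i') i} = {i, i'} := by
    ext m
    simp [value_pairNormal_eq_iff]
  have := isExposed_intFunctional_level _ _ (value_pairNormal_le i i')
  rwa [intFunctional_level _ _ (value_pairNormal_le i i'), hset, image_pair] at this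

theorem isVertex_realPoint (i : Fin 10) : IsVertex hull (realPoint i) := by
  simpa [IsVertex] using isExposed_pair i i

theorem vertexSet_hull : vertexSet hull = range realPoint := by
  apply Subset.antisymm
  · intro v hv
    exact extremePoints_convexHull_subset
      (exposedPoints_subset_extremePoints (mem_exposedPoints_iff_exposed_singleton.2 hv))
  · rintro _ ⟨i, rfl⟩
    exact isVertex_realPoint i

theorem twoNeighborly_hull : TwoNeighborly hull := by
  intro u v hu hv huv
  have hu' : u ∈ range realPoint := vertexSet_hull ▸ hu
  have hv' : v ∈ range realPoint := vertexSet_hull ▸ hv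
  obtain ⟨i, rfl⟩ := hu'
  obtain ⟨i', rfl⟩ := hv'
  exact ⟨isExposed_pair i i', pdim_convexHull_pair huv⟩

/-! ### Dimension -/

theorem dual_apply_eq_of_mem {V : Type*} [AddCommGroup V] [Module ℝ V] {A : Set V}
    {f : Module.Dual ℝ V} (hf : ∀ x ∈ vectorSpan ℝ A, f x = 0) {x y : V} (hx : x ∈ A)
    (hy : y ∈ A) : f x = f y :=
  sub_eq_zero.1 (by simpa using hf _ (vsub_mem_vectorSpan ℝ hx hy))

theorem pdim_hull : pdim hull = 6 := by
  rw [hull, pdim_convexHull, finrank_eq_of_forall_dual_eq_zero, Module.finrank_fin_fun]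
  intro f hf
  have hc (i : Fin 10) : f (realPoint i) = f (realPoint 0) :=
    dual_apply_eq_of_mem hf ⟨i, rfl⟩ ⟨0, rfl⟩
  rw [linearMap_eq_functional f] at hc ⊢
  set c : Fin 6 → ℝ := fun j => f (Pi.single j 1)
  simp only [ContinuousLinearMap.coe_coe, functional_apply, Fin.sum_univ_six] at hc
  have h1 := hc 1
  have h2 := hc 2
  have h3 := hc 3
  have h4 := hc 4
  have h5 := hc 5
  have h6 := hc 6
  have h7 := hc 7
  have h8 := hc 8
  have h9 := hc 9
  simp [realPoint, point] at h1 h2 h3 h4 h5 h6 h7 h8 h9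
  have hzero : c = 0 := by
    ext j
    fin_cases j <;> simp <;> linarith
  ext j
  simp [functional_apply, hzero]

/-- The facet with the given index. -/
def facet (k : Fin 15) : Set (Fin 6 → ℝ) := {x ∈ hull | intFunctional (normal k) x = offset k}

theorem realPoint_mem_facet (k : Fin 15) (i : Fin 10) :
    realPoint i ∈ facet k ↔ value (normal k) i = offset k := by
  simp [facet, realPoint_mem_hull, intFunctional_realPoint]

theorem facet_injective : Function.Injective facet := fun k k' h =>
  normal_separated k k' fun i => by rw [← realPoint_mem_facet, ← realPoint_mem_facet, h]

set_option maxHeartbeats 2000000 in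
/-- A functional that is constant on the points of a facet is a multiple of its normal. -/
theorem eq_mul_normal (k : Fin 15) (c : Fin 6 → ℝ) (b : ℝ)
    (h : ∀ i, value (normal k) i = offset k → ∑ j, c j * realPoint i j = b) (j : Fin 6) :
    c j = c (pivot k) * normal k (pivot k) * normal k j := by
  have h0 := h 0
  have h1 := h 1
  have h2 := h 2
  have h3 := h 3
  have h4 := h 4
  have h5 := h 5
  have h6 := h 6
  have h7 := h 7
  have h8 := h 8
  have h9 := h 9
  clear h
  simp [Fin.sum_univ_six, realPoint, point] at h0 h1 h2 h3 h4 h5 h6 h7 h8 h9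
  fin_cases k <;> simp [point, normal, offset, value, Fin.sum_univ_six, pivot]
    at h0 h1 h2 h3 h4 h5 h6 h7 h8 h9 ⊢ <;> fin_cases j <;> simp <;> linarith

theorem pdim_facet (k : Fin 15) : pdim (facet k) + 1 = 6 := by
  rw [facet, intFunctional_level _ _ (value_normal_le k), pdim_convexHull,
    finrank_add_one_of_forall_dual _ (intFunctional (normal k)).toLinearMap,
    Module.finrank_fin_fun]
  · intro h
    have hp := LinearMap.congr_fun h (Pi.single (pivot k) 1)
    have hsq := normal_pivot_sq k
    simp [intFunctional, functional_apply, Pi.single_apply] at hp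
    simp [hp] at hsq
  · refine vectorSpan_dual_eq_zero (b := offset k) ?_
    rintro _ ⟨i, hi, rfl⟩
    have hi' : value (normal k) i = offset k := hi
    simp [intFunctional_realPoint, hi']
  · intro f hf
    have hf' := linearMap_eq_functional f
    set c : Fin 6 → ℝ := fun j => f (Pi.single j 1)
    obtain ⟨i₀, hi₀⟩ := exists_value_normal_eq k
    have key := eq_mul_normal k c (f (realPoint i₀)) fun i hi => by
      rw [← functional_apply, ← dual_apply_eq_of_mem hf ⟨i, hi, rfl⟩ ⟨i₀, hi₀, rfl⟩, hf']
      rfl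
    refine ⟨c (pivot k) * normal k (pivot k), ?_⟩
    ext j
    simp only [LinearMap.comp_apply, LinearMap.single_apply, LinearMap.smul_apply]
    change c j = _
    rw [key j]
    simp [intFunctional, functional_apply, Pi.single_apply]

/-! ### The list of facets is complete -/

theorem sum_three_eq_zero_iff {x y z : ℝ} (hx : 0 ≤ x) (hy : 0 ≤ y) (hz : 0 ≤ z) :
    x + y + z = 0 ↔ x = 0 ∧ y = 0 ∧ z = 0 := by
  rw [add_eq_zero_iff_of_nonneg (add_nonneg hx hy) hz, add_eq_zero_iff_of_nonneg hx hy, and_assoc]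

/-- The maximizers of a functional among the ten points are all of them, or lie on a facet. -/
theorem maximizers_subset_facet (l : Module.Dual ℝ (Fin 6 → ℝ)) (M : ℝ)
    (h : ∀ i, l (realPoint i) ≤ M) :
    (∀ i, l (realPoint i) = M) ∨
      ∃ k, ∀ i, l (realPoint i) = M → value (normal k) i = offset k := by
  classical
  obtain ⟨d, hd⟩ : ∃ d : Fin 10 → ℝ, ∀ i, d i = M - l (realPoint i) := ⟨_, fun _ => rfl⟩
  have hd0 (i : Fin 10) : 0 ≤ d i := by rw [hd]; linarith [h i]
  have hiff (i : Fin 10) : l (realPoint i) = M ↔ d i = 0 := by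
    rw [hd, sub_eq_zero, eq_comm]
  have e₁ : d 0 + d 1 + d 5 = d 2 + d 3 + d 4 := by
    have : realPoint 0 + realPoint 1 + realPoint 5 = realPoint 2 + realPoint 3 + realPoint 4 := by
      have : ∀ j, point 0 j + point 1 j + point 5 j =
          point 2 j + point 3 j + point 4 j := by decide
      ext j
      simp only [Pi.add_apply, realPoint]
      exact_mod_cast this j
    have := congrArg l this
    simp only [map_add] at this
    simp only [hd]
    linarith
  have e₂ : d 1 + d 3 + d 6 = d 0 + d 2 + d 7 := by
    have : realPoint 1 + realPoint 3 + realPoint 6 = realPoint 0 + realPoint 2 + realPoint 7 := by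
      have : ∀ j, point 1 j + point 3 j + point 6 j =
          point 0 j + point 2 j + point 7 j := by decide
      ext j
      simp only [Pi.add_apply, realPoint]
      exact_mod_cast this j
    have := congrArg l this
    simp only [map_add] at this
    simp only [hd]
    linarith
  have e₃ : d 0 + d 4 + 2 * d 9 = d 3 + d 5 + 2 * d 8 := by
    have : realPoint 0 + realPoint 4 + (2 : ℝ) • realPoint 9 =
        realPoint 3 + realPoint 5 + (2 : ℝ) • realPoint 8 := by
      have : ∀ j, point 0 j + point 4 j + 2 * point 9 j =
          point 3 j + point 5 j + 2 * point 8 j := by decide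
      ext j
      simp only [Pi.add_apply, Pi.smul_apply, smul_eq_mul, realPoint]
      exact_mod_cast this j
    have := congrArg l this
    simp only [map_add, map_smul, smul_eq_mul] at this
    simp only [hd]
    linarith
  have hd2 (i : Fin 10) : 0 ≤ 2 * d i := by linarith [hd0 i]
  have key := closed_subset_facet (decide (d 0 = 0)) (decide (d 1 = 0)) (decide (d 2 = 0))
    (decide (d 3 = 0)) (decide (d 4 = 0)) (decide (d 5 = 0)) (decide (d 6 = 0))
    (decide (d 7 = 0)) (decide (d 8 = 0)) (decide (d 9 = 0))
    (by
      have := sum_three_eq_zero_iff (hd0 0) (hd0 1) (hd0 5)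
      rw [e₁, sum_three_eq_zero_iff (hd0 2) (hd0 3) (hd0 4)] at this
      simp only [← Bool.decide_and, and_assoc, decide_eq_decide]
      exact this.symm)
    (by
      have := sum_three_eq_zero_iff (hd0 1) (hd0 3) (hd0 6)
      rw [e₂, sum_three_eq_zero_iff (hd0 0) (hd0 2) (hd0 7)] at this
      simp only [← Bool.decide_and, and_assoc, decide_eq_decide]
      exact this.symm)
    (by
      have := sum_three_eq_zero_iff (hd0 0) (hd0 4) (hd2 9)
      rw [e₃, sum_three_eq_zero_iff (hd0 3) (hd0 5) (hd2 8)] at this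
      simp only [mul_eq_zero, OfNat.ofNat_ne_zero, false_or] at this
      simp only [← Bool.decide_and, and_assoc, decide_eq_decide]
      exact this.symm)
  have hvec : ![decide (d 0 = 0), decide (d 1 = 0), decide (d 2 = 0), decide (d 3 = 0),
      decide (d 4 = 0), decide (d 5 = 0), decide (d 6 = 0), decide (d 7 = 0), decide (d 8 = 0),
      decide (d 9 = 0)] = fun i => decide (d i = 0) := by
    ext i; fin_cases i <;> rfl
  rw [hvec] at key
  simpa only [hiff, decide_eq_true_eq] using key

theorem facetSet_hull : facetSet hull = range facet := by
  apply Subset.antisymm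
  · rintro F ⟨hexp, hne, hdim⟩
    obtain ⟨l, hF⟩ := hexp hne
    obtain ⟨x₀, hx₀⟩ := hne
    have hx₀' := hx₀
    rw [hF] at hx₀'
    obtain ⟨hx₀P, hmax⟩ := hx₀'
    have hM (i : Fin 10) : l (realPoint i) ≤ l x₀ := hmax _ (realPoint_mem_hull i)
    have hlevel : F = {x ∈ hull | l x = l x₀} := by
      rw [hF]
      ext x
      exact ⟨fun hx => ⟨hx.1, le_antisymm (hmax x hx.1) (hx.2 x₀ hx₀P)⟩,
        fun hx => ⟨hx.1, fun y hy => hx.2 ▸ hmax y hy⟩⟩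
    have hhull : F = convexHull ℝ (realPoint '' {i | l (realPoint i) = l x₀}) :=
      hlevel.trans (convexHull_range_inter_level realPoint l.toLinearMap (l x₀) hM)
    rcases maximizers_subset_facet l.toLinearMap (l x₀) hM with hall | ⟨k, hk⟩
    · have huniv : {i | l (realPoint i) = l x₀} = univ := eq_univ_of_forall hall
      have : F = hull := by rw [hhull, huniv, image_univ, hull]
      rw [this] at hdim
      omega
    · refine ⟨k, ?_⟩
      have hsub : F ⊆ facet k := by
        rw [hhull, facet, intFunctional_level _ _ (value_normal_le k)]
        exact convexHull_mono (image_mono hk)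
      have hpd := pdim_facet k
      rw [pdim_hull] at hdim
      refine Subset.antisymm (fun x hx => ?_) hsub
      rw [hlevel]
      refine ⟨hx.1, ?_⟩
      have hxF := subset_affineSpan_of_pdim_eq hsub ⟨x₀, hx₀⟩ (by omega) hx
      have hd := vectorSpan_dual_eq_zero (A := F) (f := l.toLinearMap) (b := l x₀)
        (fun y hy => by rw [hlevel] at hy; exact hy.2) (x - x₀)
        (by
          rw [← direction_affineSpan]
          exact AffineSubspace.vsub_mem_direction hxF (subset_affineSpan ℝ F hx₀))
      simpa [sub_eq_zero] using hd
  · rintro _ ⟨k, rfl⟩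
    obtain ⟨i, hi⟩ := exists_value_normal_eq k
    exact ⟨isExposed_intFunctional_level _ _ (value_normal_le k),
      ⟨realPoint i, (realPoint_mem_facet k i).2 hi⟩, by rw [pdim_facet, pdim_hull]⟩

theorem ncard_facetSet_hull : (facetSet hull).ncard = 15 := by
  rw [facetSet_hull, ← image_univ, ncard_image_of_injective _ facet_injective, ncard_univ,
    Nat.card_eq_fintype_card, Fintype.card_fin]

end TenPointPolytope

/-- The convex hull `P` of the ten listed points in `ℝ^6` is a 6-polytope whose
vertex set is exactly this set of points, `P` is 2-neighborly, and `P` has exactly 15 facets. -/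
theorem P61015_two_neighborly :
    ∀ S : Set (Fin 6 → ℝ), S = {![1,1,1,1,1,0], ![1,1,1,1,-1,0], ![1,1,1,-1,1,0],
        ![1,1,-1,1,1,0], ![1,-1,1,1,-1,0], ![1,-1,-1,-1,1,0], ![-1,1,1,-1,1,0],
        ![-1,1,-1,1,-1,0], ![0,0,1,1,0,1], ![0,0,-1,0,1,1]} →
    ∀ P : Set (Fin 6 → ℝ), P = convexHull ℝ S →
      IsPolytope P ∧ pdim P = 6 ∧ vertexSet P = S ∧ TwoNeighborly P ∧
      (facetSet P).ncard = 15 := by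
  rintro S rfl P rfl
  rw [← TenPointPolytope.range_realPoint]
  exact ⟨⟨(finite_range TenPointPolytope.realPoint).toFinset, by simp⟩,
    TenPointPolytope.pdim_hull, TenPointPolytope.vertexSet_hull,
    TenPointPolytope.twoNeighborly_hull, TenPointPolytope.ncard_facetSet_hull⟩
end

section
/- Let S ⊂ ℝ^7 be the set of fourteen points (0,0,0,0,0,0,0), (0,0,0,0,0,0,1), (0,0,0,0,0,1,0), (0,0,0,0,1,0,0), (0,0,0,1,0,0,0), (0,0,1,0,0,0,0), (0,1,0,0,0,0,0), (1,0,0,0,0,1,1), (1,0,0,1,1,0,0), (1,0,1,0,1,0,1), (1,0,1,1,0,1,0), (1,1,0,0,1,1,0), (1,1,0,1,0,0,1), (1,1,1,0,0,0,0), and let P be the convex hull of S. Then P is a 7-polytope whose vertex set is exactly S, P is 2-neighborly, and P has exactly 16 facets. -/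
open Set

namespace FanoPolytope

/-- The fourteen points: the first seven correspond to the points of the Fano plane, the last
seven to its lines. -/
def point : Fin 14 → Fin 7 → ℤ :=
  ![![0, 0, 0, 0, 0, 0, 0],
    ![0, 0, 0, 0, 0, 0, 1],
    ![0, 0, 0, 0, 0, 1, 0],
    ![0, 0, 0, 0, 1, 0, 0],
    ![0, 0, 0, 1, 0, 0, 0],
    ![0, 0, 1, 0, 0, 0, 0],
    ![0, 1, 0, 0, 0, 0, 0],
    ![1, 0, 0, 0, 0, 1, 1],
    ![1, 0, 0, 1, 1, 0, 0],
    ![1, 0, 1, 0, 1, 0, 1],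
    ![1, 0, 1, 1, 0, 1, 0],
    ![1, 1, 0, 0, 1, 1, 0],
    ![1, 1, 0, 1, 0, 0, 1],
    ![1, 1, 1, 0, 0, 0, 0]]

/-- Outer normals of the sixteen facets. -/
def normal : Fin 16 → Fin 7 → ℤ :=
  ![![-1, 0, 0, 0, 0, 0, 0],
    ![-2, 1, 1, 1, 1, 1, 1],
    ![0, 0, 0, 0, 0, 0, -1],
    ![0, 0, 0, 0, 0, -1, 0],
    ![0, 0, 0, 0, -1, 0, 0],
    ![0, 0, 0, -1, 0, 0, 0],
    ![0, 0, -1, 0, 0, 0, 0],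
    ![0, -1, 0, 0, 0, 0, 0],
    ![-1, 1, 1, 1, 1, 0, 0],
    ![-1, 1, 1, 0, 0, 1, 1],
    ![1, 0, -1, 0, -1, 0, -1],
    ![1, 0, -1, -1, 0, -1, 0],
    ![1, -1, 0, 0, -1, -1, 0],
    ![1, -1, 0, -1, 0, 0, -1],
    ![-1, 0, 0, 1, 1, 1, 1],
    ![1, 0, 0, 0, 0, 0, 0]]

/-- Maximal values of the facet normals. -/
def bound : Fin 16 → ℤ := ![0, 1, 0, 0, 0, 0, 0, 0, 1, 1, 0, 0, 0, 0, 1, 1]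

/-- A coordinate at which the facet normal does not vanish. -/
def pivot : Fin 16 → Fin 7 := ![0, 0, 6, 5, 4, 3, 2, 1, 0, 0, 0, 0, 0, 0, 3, 0]

/-- Seven affinely independent vertices of each facet. -/
def facetBasis : Fin 16 → Fin 7 → Fin 14 :=
  ![![0, 1, 2, 3, 4, 5, 6],
    ![1, 2, 3, 4, 5, 6, 9],
    ![0, 2, 3, 4, 5, 6, 8],
    ![0, 1, 3, 4, 5, 6, 8],
    ![0, 1, 2, 4, 5, 6, 7],
    ![0, 1, 2, 3, 5, 6, 7],
    ![0, 1, 2, 3, 4, 6, 7],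
    ![0, 1, 2, 3, 4, 5, 7],
    ![3, 4, 5, 6, 8, 9, 10],
    ![1, 2, 5, 6, 7, 9, 10],
    ![0, 2, 4, 6, 7, 8, 10],
    ![0, 1, 3, 6, 7, 8, 9],
    ![0, 1, 4, 5, 7, 8, 12],
    ![0, 2, 3, 5, 7, 8, 11],
    ![1, 2, 3, 4, 7, 9, 11],
    ![7, 8, 9, 10, 11, 12, 13]]

/-- The slack of a point with respect to a facet inequality. -/
def slack (j : Fin 16) (i : Fin 14) : ℤ := bound j - ∑ k, normal j k * point i k

lemma slack_nonneg : ∀ j i, 0 ≤ slack j i := by decide +kernel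

lemma normal_pivot_ne_zero : ∀ j, normal j (pivot j) ≠ 0 := by decide +kernel

lemma exists_slack_eq_zero : ∀ j, ∃ i, slack j i = 0 := by decide +kernel

lemma slack_facetBasis : ∀ j m, slack j (facetBasis j m) = 0 := by decide +kernel

lemma eq_of_slack_eq_zero_iff :
    ∀ j j', (∀ i, slack j i = 0 ↔ slack j' i = 0) → j = j' := by decide +kernel

lemma exists_separating_facet : ∀ i k m, m ≠ i → m ≠ k →
    ∃ j, slack j i = 0 ∧ slack j k = 0 ∧ slack j m ≠ 0 := by decide +kernel

/-- The points, as real vectors. -/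
def vec (i : Fin 14) (k : Fin 7) : ℝ := point i k

/-- The functional with the given coefficients. -/
noncomputable def dual (c : Fin 7 → ℝ) : StrongDual ℝ (Fin 7 → ℝ) :=
  ∑ k, c k • ContinuousLinearMap.proj k

lemma dual_apply (c x : Fin 7 → ℝ) : dual c x = ∑ k, c k * x k := by
  simp [dual]

lemma exists_eq_dual (f : StrongDual ℝ (Fin 7 → ℝ)) : ∃ c, f = dual c := by
  refine ⟨fun k => f (fun j => if k = j then 1 else 0), ?_⟩
  ext1 x
  have := LinearMap.pi_apply_eq_sum_univ f.toLinearMap x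
  simp only [ContinuousLinearMap.coe_coe, smul_eq_mul] at this
  rw [this, dual_apply]
  exact Finset.sum_congr rfl fun _ _ => mul_comm _ _

/-- The functional of the facet normal. -/
noncomputable def facetDual (j : Fin 16) : StrongDual ℝ (Fin 7 → ℝ) := dual fun k => normal j k

lemma facetDual_vec (j : Fin 16) (i : Fin 14) :
    facetDual j (vec i) = bound j - slack j i := by
  simp [facetDual, dual_apply, slack, vec]

lemma facetDual_vec_le (j : Fin 16) (i : Fin 14) : facetDual j (vec i) ≤ bound j := by
  rw [facetDual_vec]
  have : (0 : ℝ) ≤ slack j i := by exact_mod_cast slack_nonneg j i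
  linarith

lemma facetDual_vec_eq_iff (j : Fin 16) (i : Fin 14) :
    facetDual j (vec i) = bound j ↔ slack j i = 0 := by
  rw [facetDual_vec, sub_eq_self, Int.cast_eq_zero]

lemma facetDual_ne_zero (j : Fin 16) : facetDual j ≠ 0 := by
  intro h
  have := congrArg (fun f : StrongDual ℝ (Fin 7 → ℝ) => f (Pi.single (pivot j) 1)) h
  simp [facetDual, dual_apply, Pi.single_apply, normal_pivot_ne_zero] at this

section Exposed

variable {E : Type*} [AddCommGroup E] [Module ℝ E] {S : Set E} {M : ℝ}

lemma le_of_mem_convexHull {l : E →ₗ[ℝ] ℝ} (h : ∀ s ∈ S, l s ≤ M) {x : E}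
    (hx : x ∈ convexHull ℝ S) : l x ≤ M :=
  convexHull_min (t := {y | l y ≤ M}) h (convex_halfSpace_le l.isLinear M) hx

lemma eq_of_mem_convexHull {l : E →ₗ[ℝ] ℝ} (h : ∀ s ∈ S, l s = M) {x : E}
    (hx : x ∈ convexHull ℝ S) : l x = M :=
  convexHull_min (t := {y | l y = M}) h (convex_hyperplane l.isLinear M) hx

/-- A point of a convex hull at which a functional attains the maximum of its values on the
generators is in the convex hull of the maximizing generators. -/
lemma mem_convexHull_maximizers {l : E →ₗ[ℝ] ℝ} (h : ∀ s ∈ S, l s ≤ M) {x : E}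
    (hx : x ∈ convexHull ℝ S) (hlx : l x = M) : x ∈ convexHull ℝ {s ∈ S | l s = M} := by
  classical
  obtain ⟨ι, _, w, z, hw, hw1, hz, rfl⟩ := mem_convexHull_iff_exists_fintype.1 hx
  have hsum : ∑ i, w i * (M - l (z i)) = 0 := by
    simp only [map_sum, map_smul, smul_eq_mul] at hlx
    simp only [mul_sub, Finset.sum_sub_distrib, ← Finset.sum_mul, hw1, hlx]
    ring
  have hzero := (Finset.sum_eq_zero_iff_of_nonneg fun i _ =>
    mul_nonneg (hw i) (sub_nonneg.2 (h _ (hz i)))).1 hsum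
  have hsub : ∑ i, w i • z i = ∑ i with w i ≠ 0, w i • z i := by
    rw [Finset.sum_filter_of_ne]
    intro i _ hi hwi
    simp [hwi] at hi
  rw [hsub]
  refine (convex_convexHull ℝ _).sum_mem (fun i _ => hw i)
    (by rw [Finset.sum_filter_ne_zero, hw1]) fun i hi => subset_convexHull ℝ _ ⟨hz i, ?_⟩
  have hi' := (mul_eq_zero.1 (hzero i (Finset.mem_univ i))).resolve_left (Finset.mem_filter.1 hi).2
  linarith

end Exposed

/-- The polytope. -/
def hull : Set (Fin 7 → ℝ) := convexHull ℝ (range vec)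

lemma vec_mem_hull (i : Fin 14) : vec i ∈ hull := subset_convexHull ℝ _ ⟨i, rfl⟩

/-- If every maximizer of `l` among the vertices satisfies `g = b`, then so does every maximizer
of `l` on the polytope. -/
lemma eq_of_maximizer {l g : StrongDual ℝ (Fin 7 → ℝ)} {M b : ℝ} (hl : ∀ i, l (vec i) ≤ M)
    (hg : ∀ i, l (vec i) = M → g (vec i) = b) {x : Fin 7 → ℝ} (hx : x ∈ hull) (hlx : l x = M) :
    g x = b := by
  have := mem_convexHull_maximizers (l := l.toLinearMap) (M := M) (by rintro _ ⟨i, rfl⟩; exact hl i)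
    hx hlx
  refine eq_of_mem_convexHull (l := g.toLinearMap) ?_ this
  rintro _ ⟨⟨i, rfl⟩, hi⟩
  exact hg i hi

lemma le_of_mem_hull {l : StrongDual ℝ (Fin 7 → ℝ)} {M : ℝ} (hl : ∀ i, l (vec i) ≤ M)
    {x : Fin 7 → ℝ} (hx : x ∈ hull) : l x ≤ M :=
  le_of_mem_convexHull (l := l.toLinearMap) (by rintro _ ⟨i, rfl⟩; exact hl i) hx

lemma isExposed_maximizers {l : StrongDual ℝ (Fin 7 → ℝ)} {M : ℝ} (hl : ∀ i, l (vec i) ≤ M)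
    {i₀ : Fin 14} (h₀ : l (vec i₀) = M) : IsExposed ℝ hull {x ∈ hull | l x = M} := by
  intro _
  refine ⟨l, Set.ext fun x => and_congr_right fun hx => ?_⟩
  refine ⟨fun h y hy => h ▸ le_of_mem_hull hl hy, fun h => ?_⟩
  exact le_antisymm (le_of_mem_hull hl hx) (h₀ ▸ h _ (vec_mem_hull i₀))

/-- Any two (not necessarily distinct) vertices span an exposed face. -/
lemma isExposed_pair (i k : Fin 14) : IsExposed ℝ hull (convexHull ℝ {vec i, vec k}) := by
  classical
  set J : Finset (Fin 16) := {j | slack j i = 0 ∧ slack j k = 0} with hJ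
  set l : StrongDual ℝ (Fin 7 → ℝ) := ∑ j ∈ J, facetDual j with hl
  set M : ℝ := ∑ j ∈ J, (bound j : ℝ) with hM
  have hval : ∀ m, l (vec m) = M - ∑ j ∈ J, (slack j m : ℝ) := fun m => by
    simp [hl, hM, facetDual_vec]
  have hnonneg : ∀ m, ∀ j ∈ J, (0 : ℝ) ≤ slack j m := fun m j _ => by
    exact_mod_cast slack_nonneg j m
  have hle : ∀ m, l (vec m) ≤ M := fun m => by
    rw [hval]
    linarith [Finset.sum_nonneg (hnonneg m)]
  have hi : l (vec i) = M := by
    rw [hval, Finset.sum_eq_zero, sub_zero]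
    intro j hj
    simp [(Finset.mem_filter.1 hj).2.1]
  have hk : l (vec k) = M := by
    rw [hval, Finset.sum_eq_zero, sub_zero]
    intro j hj
    simp [(Finset.mem_filter.1 hj).2.2]
  have htight : ∀ m, l (vec m) = M → m = i ∨ m = k := by
    intro m hm
    by_contra! hne
    obtain ⟨j, h1, h2, h3⟩ := exists_separating_facet i k m hne.1 hne.2
    have h0 : ∑ j ∈ J, (slack j m : ℝ) = 0 := by linarith [hval m]
    have := (Finset.sum_eq_zero_iff_of_nonneg (hnonneg m)).1 h0 j (by simp [hJ, h1, h2])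
    exact h3 (by exact_mod_cast this)
  have hset : convexHull ℝ {vec i, vec k} = {x ∈ hull | l x = M} := by
    ext x
    constructor
    · refine fun hx => ⟨convexHull_mono ?_ hx,
        eq_of_mem_convexHull (l := l.toLinearMap) ?_ hx⟩
      · rintro _ (rfl | rfl) <;> exact ⟨_, rfl⟩
      · rintro _ (rfl | rfl) <;> assumption
    · intro hx
      refine convexHull_mono ?_ (mem_convexHull_maximizers (l := l.toLinearMap) (M := M)
        (by rintro _ ⟨m, rfl⟩; exact hle m) hx.1 hx.2)
      rintro _ ⟨⟨m, rfl⟩, hm⟩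
      rcases htight m hm with rfl | rfl <;> simp
  rw [hset]
  exact isExposed_maximizers hle hi

lemma isVertex_vec (i : Fin 14) : IsVertex hull (vec i) := by
  have := isExposed_pair i i
  rwa [Set.pair_eq_singleton, convexHull_singleton] at this

lemma vertexSet_hull : vertexSet hull = range vec := by
  refine subset_antisymm (fun x hx => ?_) ?_
  · exact extremePoints_convexHull_subset (isExtreme_singleton.1 (IsExposed.isExtreme hx))
  · rintro _ ⟨i, rfl⟩
    exact isVertex_vec i

section Dimension

variable {N : ℕ}

lemma pdim_convexHull_pair {u v : Fin N → ℝ} (h : u ≠ v) :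
    pdim (convexHull ℝ ({u, v} : Set (Fin N → ℝ))) = 1 := by
  rw [pdim, affineSpan_convexHull, direction_affineSpan, vectorSpan_pair]
  exact finrank_span_singleton (by simpa [sub_eq_zero] using h)

/-- The functionals vanishing on the direction of the affine span of `X` are those constant
on `X`. -/
lemma mem_dualAnnihilator_direction_iff {X : Set (Fin N → ℝ)}
    {f : Module.Dual ℝ (Fin N → ℝ)} :
    f ∈ (affineSpan ℝ X).direction.dualAnnihilator ↔ ∀ x ∈ X, ∀ y ∈ X, f x = f y := by
  rw [direction_affineSpan, vectorSpan_def, Submodule.mem_dualAnnihilator]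
  constructor
  · intro h x hx y hy
    have := h (x - y) (Submodule.subset_span ⟨x, hx, y, hy, rfl⟩)
    rwa [map_sub, sub_eq_zero] at this
  · intro h w hw
    have : Submodule.span ℝ (X -ᵥ X) ≤ LinearMap.ker f := by
      rw [Submodule.span_le]
      rintro _ ⟨x, hx, y, hy, rfl⟩
      simp [h x hx y hy]
    exact this hw

lemma pdim_add_finrank_dualAnnihilator (X : Set (Fin N → ℝ)) :
    pdim X + Module.finrank ℝ (affineSpan ℝ X).direction.dualAnnihilator = N := by
  rw [pdim, Subspace.finrank_add_finrank_dualAnnihilator_eq, Module.finrank_fin_fun]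

end Dimension

/-- A functional which is constant on the vertices is zero. -/
lemma dual_eq_zero {c : Fin 7 → ℝ} {d : ℝ} (h : ∀ i, dual c (vec i) = d) : dual c = 0 := by
  have hc : c = 0 := by
    simp only [dual_apply, vec] at h
    have h0 := h 0
    have h1 := h 1
    have h2 := h 2
    have h3 := h 3
    have h4 := h 4
    have h5 := h 5
    have h6 := h 6
    have h7 := h 7
    simp [point, Fin.sum_univ_succ] at h0 h1 h2 h3 h4 h5 h6 h7
    ext k
    fin_cases k <;> simp <;> linarith
  simp [hc, dual]

set_option maxHeartbeats 2000000 in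
/-- A functional which is constant on the vertices of a facet is a multiple of its normal. -/
lemma dual_eq_smul_facetDual (j : Fin 16) {c : Fin 7 → ℝ} {d : ℝ}
    (h : ∀ i, slack j i = 0 → dual c (vec i) = d) :
    dual c = (c (pivot j) / normal j (pivot j)) • facetDual j := by
  have key : ∀ k, (normal j (pivot j) : ℝ) * c k = c (pivot j) * normal j k := by
    have hb : ∀ m, dual c (vec (facetBasis j m)) = d := fun m => h _ (slack_facetBasis j m)
    clear h
    simp only [dual_apply, vec, Fin.forall_fin_succ, IsEmpty.forall_iff] at hb
    fin_cases j <;> simp [facetBasis, point, Fin.sum_univ_succ] at hb <;>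
      obtain ⟨_, _, _, _, _, _, _⟩ := hb <;>
      simp [Fin.forall_fin_succ, normal, pivot] <;> constructorm* _ ∧ _ <;> linarith
  have hp : (normal j (pivot j) : ℝ) ≠ 0 := by exact_mod_cast normal_pivot_ne_zero j
  ext1 x
  simp only [facetDual, dual_apply, smul_apply, smul_eq_mul, Finset.mul_sum]
  refine Finset.sum_congr rfl fun k _ => ?_
  field_simp
  linear_combination x k * key k

lemma pdim_hull : pdim hull = 7 := by
  have h : (affineSpan ℝ hull).direction.dualAnnihilator = ⊥ := by
    refine eq_bot_iff.2 fun f hf => ?_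
    rw [mem_dualAnnihilator_direction_iff] at hf
    obtain ⟨c, hc⟩ := exists_eq_dual (LinearMap.toContinuousLinearMap f)
    have h0 : dual c = 0 := dual_eq_zero (d := f (vec 0)) fun i => by
      rw [← hc]
      exact hf _ (vec_mem_hull i) _ (vec_mem_hull 0)
    rw [h0] at hc
    simpa using hc
  have := pdim_add_finrank_dualAnnihilator hull
  rwa [h, finrank_bot, add_zero] at this

/-- The sixteen facets. -/
def face (j : Fin 16) : Set (Fin 7 → ℝ) := {x ∈ hull | facetDual j x = bound j}

lemma vec_mem_face_iff (j : Fin 16) (i : Fin 14) : vec i ∈ face j ↔ slack j i = 0 := by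
  rw [← facetDual_vec_eq_iff]
  exact and_iff_right (vec_mem_hull i)

lemma face_injective : Function.Injective face := fun j j' h =>
  eq_of_slack_eq_zero_iff j j' fun i => by rw [← vec_mem_face_iff, h, vec_mem_face_iff]

lemma pdim_face (j : Fin 16) : pdim (face j) = 6 := by
  have h : (affineSpan ℝ (face j)).direction.dualAnnihilator =
      Submodule.span ℝ {(facetDual j).toLinearMap} := by
    refine le_antisymm (fun f hf => ?_) ?_
    · rw [mem_dualAnnihilator_direction_iff] at hf
      obtain ⟨c, hc⟩ := exists_eq_dual (LinearMap.toContinuousLinearMap f)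
      obtain ⟨i₀, hi₀⟩ := exists_slack_eq_zero j
      have h0 := dual_eq_smul_facetDual j (c := c) (d := f (vec i₀)) fun i hi => by
        rw [← hc]
        exact hf _ ((vec_mem_face_iff j i).2 hi) _ ((vec_mem_face_iff j i₀).2 hi₀)
      rw [Submodule.mem_span_singleton]
      refine ⟨c (pivot j) / normal j (pivot j), LinearMap.ext fun x => ?_⟩
      exact (congrArg (fun g : StrongDual ℝ (Fin 7 → ℝ) => g x) (hc.trans h0)).symm
    · rw [Submodule.span_singleton_le_iff_mem, mem_dualAnnihilator_direction_iff]
      exact fun x hx y hy => hx.2.trans hy.2.symm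
  have hne : (facetDual j).toLinearMap ≠ 0 := fun h0 =>
    facetDual_ne_zero j (ContinuousLinearMap.coe_injective h0)
  have := pdim_add_finrank_dualAnnihilator (face j)
  rw [h, finrank_span_singleton hne] at this
  omega

lemma face_nonempty (j : Fin 16) : (face j).Nonempty :=
  (exists_slack_eq_zero j).imp' vec fun i hi => (vec_mem_face_iff j i).2 hi

lemma isFacetOf_face (j : Fin 16) : IsFacetOf hull (face j) := by
  obtain ⟨i, hi⟩ := exists_slack_eq_zero j
  refine ⟨isExposed_maximizers (facetDual_vec_le j) ((facetDual_vec_eq_iff j i).2 hi),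
    face_nonempty j, ?_⟩
  rw [pdim_face, pdim_hull]

/-- A fractional blocking set of the Fano plane that vanishes at a point cannot have total weight
`m` on every line of positive weights, where `m` is the blocking threshold. The variables are the
weights of the six other points, paired along the lines through the given point. -/
lemma blocking_contradiction {m x x' y y' z z' : ℝ} (hm : 0 < m)
    (hxx : m ≤ x + x') (hyy : m ≤ y + y') (hzz : m ≤ z + z')
    (h₁ : m ≤ x + y + z) (h₂ : m ≤ x + y' + z') (h₃ : m ≤ x' + y + z') (h₄ : m ≤ x' + y' + z)
    (t₁ : m = x + y + z ∨ x = 0 ∨ y = 0 ∨ z = 0)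
    (t₂ : m = x + y' + z' ∨ x = 0 ∨ y' = 0 ∨ z' = 0)
    (t₃ : m = x' + y + z' ∨ x' = 0 ∨ y = 0 ∨ z' = 0)
    (t₄ : m = x' + y' + z ∨ x' = 0 ∨ y' = 0 ∨ z = 0) : False := by
  rcases t₁ with t₁ | t₁ | t₁ | t₁ <;> rcases t₂ with t₂ | t₂ | t₂ | t₂ <;>
    rcases t₃ with t₃ | t₃ | t₃ | t₃ <;> rcases t₄ with t₄ | t₄ | t₄ | t₄ <;> linarith

/-- The slack vector of an arbitrary valid inequality vanishes only where the slack vector of some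
facet vanishes. -/
lemma exists_facet_of_slack {s : Fin 14 → ℝ} {h : ℝ} (hs : ∀ i, 0 ≤ s i)
    (h₀ : s 7 = h + (s 0 + s 1 + s 2)) (h₁ : s 8 = h + (s 0 + s 3 + s 4))
    (h₂ : s 9 = h + (s 1 + s 3 + s 5)) (h₃ : s 10 = h + (s 2 + s 4 + s 5))
    (h₄ : s 11 = h + (s 2 + s 3 + s 6)) (h₅ : s 12 = h + (s 1 + s 4 + s 6))
    (h₆ : s 13 = h + (s 0 + s 5 + s 6)) (hne : ∃ i, s i ≠ 0) :
    ∃ j, ∀ i, s i = 0 → slack j i = 0 := by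
  have n₀ := hs 0
  have n₁ := hs 1
  have n₂ := hs 2
  have n₃ := hs 3
  have n₄ := hs 4
  have n₅ := hs 5
  have n₆ := hs 6
  rcases lt_trichotomy h 0 with hneg | rfl | hpos
  · by_contra! H
    have blocked : ∀ j i₀ i₁ i₂ i₃, (∀ i, slack j i ≠ 0 → i = i₀ ∨ i = i₁ ∨ i = i₂ ∨ i = i₃) →
        s i₀ = 0 ∨ s i₁ = 0 ∨ s i₂ = 0 ∨ s i₃ = 0 := by
      intro j i₀ i₁ i₂ i₃ hj
      obtain ⟨i, hi, hji⟩ := H j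
      rcases hj i hji with rfl | rfl | rfl | rfl <;> simp [hi]
    have b₀ := blocked 8 7 0 1 2 (by decide +kernel)
    rw [h₀] at b₀
    have b₁ := blocked 9 8 0 3 4 (by decide +kernel)
    rw [h₁] at b₁
    have b₂ := blocked 10 9 1 3 5 (by decide +kernel)
    rw [h₂] at b₂
    have b₃ := blocked 11 10 2 4 5 (by decide +kernel)
    rw [h₃] at b₃
    have b₄ := blocked 12 11 2 3 6 (by decide +kernel)
    rw [h₄] at b₄
    have b₅ := blocked 13 12 1 4 6 (by decide +kernel)
    rw [h₅] at b₅
    have b₆ := blocked 14 13 0 5 6 (by decide +kernel)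
    rw [h₆] at b₆
    have p₀ := hs 7
    rw [h₀] at p₀
    have p₁ := hs 8
    rw [h₁] at p₁
    have p₂ := hs 9
    rw [h₂] at p₂
    have p₃ := hs 10
    rw [h₃] at p₃
    have p₄ := hs 11
    rw [h₄] at p₄
    have p₅ := hs 12
    rw [h₅] at p₅
    have p₆ := hs 13
    rw [h₆] at p₆
    obtain ⟨i, hi, hi'⟩ := H 15
    have hm : 0 < -h := neg_pos.2 hneg
    have hcases : i = 0 ∨ i = 1 ∨ i = 2 ∨ i = 3 ∨ i = 4 ∨ i = 5 ∨ i = 6 := by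
      clear hi
      revert i
      decide +kernel
    rcases hcases with rfl | rfl | rfl | rfl | rfl | rfl | rfl
    · refine blocking_contradiction (x := s 1) (x' := s 2) (y := s 3) (y' := s 4)
        (z := s 5) (z' := s 6) hm (by linarith) (by linarith)
        (by linarith) (by linarith) (by linarith) (by linarith) (by linarith) ?_ ?_ ?_ ?_
      · grind
      · grind
      · grind
      · grind
    · refine blocking_contradiction (x := s 0) (x' := s 2) (y := s 3) (y' := s 5)
        (z := s 4) (z' := s 6) hm (by linarith) (by linarith)
        (by linarith) (by linarith) (by linarith) (by linarith) (by linarith) ?_ ?_ ?_ ?_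
      · grind
      · grind
      · grind
      · grind
    · refine blocking_contradiction (x := s 0) (x' := s 1) (y := s 4) (y' := s 5)
        (z := s 3) (z' := s 6) hm (by linarith) (by linarith)
        (by linarith) (by linarith) (by linarith) (by linarith) (by linarith) ?_ ?_ ?_ ?_
      · grind
      · grind
      · grind
      · grind
    · refine blocking_contradiction (x := s 0) (x' := s 4) (y := s 1) (y' := s 5)
        (z := s 2) (z' := s 6) hm (by linarith) (by linarith)
        (by linarith) (by linarith) (by linarith) (by linarith) (by linarith) ?_ ?_ ?_ ?_
      · grind
      · grind
      · grind
      · grind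
    · refine blocking_contradiction (x := s 0) (x' := s 3) (y := s 2) (y' := s 5)
        (z := s 1) (z' := s 6) hm (by linarith) (by linarith)
        (by linarith) (by linarith) (by linarith) (by linarith) (by linarith) ?_ ?_ ?_ ?_
      · grind
      · grind
      · grind
      · grind
    · refine blocking_contradiction (x := s 1) (x' := s 3) (y := s 2) (y' := s 4)
        (z := s 0) (z' := s 6) hm (by linarith) (by linarith)
        (by linarith) (by linarith) (by linarith) (by linarith) (by linarith) ?_ ?_ ?_ ?_
      · grind
      · grind
      · grind
      · grind
    · refine blocking_contradiction (x := s 2) (x' := s 3) (y := s 1) (y' := s 4)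
        (z := s 0) (z' := s 5) hm (by linarith) (by linarith)
        (by linarith) (by linarith) (by linarith) (by linarith) (by linarith) ?_ ?_ ?_ ?_
      · grind
      · grind
      · grind
      · grind
  · obtain ⟨i, hi, hi0⟩ : ∃ i : Fin 14, i < 7 ∧ s i ≠ 0 := by
      by_contra! H
      obtain ⟨i, hi⟩ := hne
      have z₀ := H 0 (by decide)
      have z₁ := H 1 (by decide)
      have z₂ := H 2 (by decide)
      have z₃ := H 3 (by decide)
      have z₄ := H 4 (by decide)
      have z₅ := H 5 (by decide)
      have z₆ := H 6 (by decide)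
      apply hi
      fin_cases i <;> first | assumption | (simp only [Fin.reduceFinMk]; linarith)
    have hcases : i = 0 ∨ i = 1 ∨ i = 2 ∨ i = 3 ∨ i = 4 ∨ i = 5 ∨ i = 6 := by
      clear hi0
      revert i
      decide +kernel
    have hpos : 0 < s i := lt_of_le_of_ne (hs i) (Ne.symm hi0)
    have facet : ∀ j i₀ i₁ i₂ i₃,
        (∀ i, slack j i ≠ 0 → i = i₀ ∨ i = i₁ ∨ i = i₂ ∨ i = i₃) →
        0 < s i₀ → 0 < s i₁ → 0 < s i₂ → 0 < s i₃ → ∃ j, ∀ i, s i = 0 → slack j i = 0 := by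
      refine fun j i₀ i₁ i₂ i₃ hj p₀ p₁ p₂ p₃ => ⟨j, fun i hi => ?_⟩
      by_contra hji
      rcases hj i hji with rfl | rfl | rfl | rfl <;> linarith
    rcases hcases with rfl | rfl | rfl | rfl | rfl | rfl | rfl
    · exact facet 1 0 7 8 13 (by decide +kernel) hpos (by linarith) (by linarith)
        (by linarith)
    · exact facet 2 1 7 9 12 (by decide +kernel) hpos (by linarith) (by linarith)
        (by linarith)
    · exact facet 3 2 7 10 11 (by decide +kernel) hpos (by linarith) (by linarith)
        (by linarith)
    · exact facet 4 3 8 9 11 (by decide +kernel) hpos (by linarith) (by linarith)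
        (by linarith)
    · exact facet 5 4 8 10 12 (by decide +kernel) hpos (by linarith) (by linarith)
        (by linarith)
    · exact facet 6 5 9 10 13 (by decide +kernel) hpos (by linarith) (by linarith)
        (by linarith)
    · exact facet 7 6 11 12 13 (by decide +kernel) hpos (by linarith) (by linarith)
        (by linarith)
  · refine ⟨0, fun i hi => ?_⟩
    by_contra hne'
    have : 7 ≤ i := by
      revert hne'
      clear hi
      revert i
      decide +kernel
    fin_cases i <;> first | (revert this; decide) | (simp only [Fin.reduceFinMk] at hi; linarith)

lemma isFacetOf_iff (F : Set (Fin 7 → ℝ)) : IsFacetOf hull F ↔ ∃ j, face j = F := by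
  refine ⟨fun ⟨hexp, hne, hdim⟩ => ?_, fun ⟨j, hj⟩ => hj ▸ isFacetOf_face j⟩
  obtain ⟨l, rfl⟩ := hexp hne
  obtain ⟨x₀, hx₀, hmax⟩ := hne
  obtain ⟨c, rfl⟩ := exists_eq_dual l
  set M := dual c x₀ with hM
  have hF : {x ∈ hull | ∀ y ∈ hull, dual c y ≤ dual c x} = {x ∈ hull | dual c x = M} :=
    Set.ext fun x => and_congr_right fun hx =>
      ⟨fun h => le_antisymm (hmax x hx) (h x₀ hx₀), fun h y hy => h ▸ hmax y hy⟩
  rw [hF] at hdim ⊢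
  have hle : ∀ i, dual c (vec i) ≤ M := fun i => hmax _ (vec_mem_hull i)
  obtain ⟨j, hj⟩ : ∃ j, ∀ i, M - dual c (vec i) = 0 → slack j i = 0 := by
    refine exists_facet_of_slack (h := -c 0 - 2 * M) (fun i => sub_nonneg.2 (hle i))
      ?_ ?_ ?_ ?_ ?_ ?_ ?_ ?_
    rotate_right
    · by_contra! hall
      have h0 : dual c = 0 := dual_eq_zero (d := M) fun i => by linarith [hall i]
      have : {x ∈ hull | dual c x = M} = hull := by
        simp [hM, h0]
      rw [this] at hdim
      omega
    all_goals
      simp [dual_apply, vec, point, Fin.sum_univ_succ]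
      ring
  have hsub : {x ∈ hull | dual c x = M} ⊆ face j := fun x hx => ⟨hx.1,
    eq_of_maximizer hle (fun i hi => (facetDual_vec_eq_iff j i).2 (hj i (by linarith))) hx.1 hx.2⟩
  refine ⟨j, subset_antisymm (fun x hx => ⟨hx.1, ?_⟩) hsub⟩
  have hdir : (affineSpan ℝ {x ∈ hull | dual c x = M}).direction =
      (affineSpan ℝ (face j)).direction := by
    refine Submodule.eq_of_le_of_finrank_eq
      (AffineSubspace.direction_le (affineSpan_mono ℝ hsub)) ?_
    change pdim _ = pdim _
    rw [pdim_face]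
    rw [pdim_hull] at hdim
    omega
  have hann : (dual c).toLinearMap ∈ (affineSpan ℝ (face j)).direction.dualAnnihilator := by
    rw [← hdir, mem_dualAnnihilator_direction_iff]
    exact fun x hx y hy => hx.2.trans hy.2.symm
  exact mem_dualAnnihilator_direction_iff.1 hann x hx x₀ (hsub ⟨hx₀, rfl⟩)

end FanoPolytope

/-- The convex hull `P` of the fourteen listed points in `ℝ^7` is a 7-polytope
whose vertex set is exactly this set of points, `P` is 2-neighborly, and `P` has exactly
16 facets. -/
theorem P71416_two_neighborly :
    ∀ S : Set (Fin 7 → ℝ), S = {![0,0,0,0,0,0,0], ![0,0,0,0,0,0,1], ![0,0,0,0,0,1,0],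
        ![0,0,0,0,1,0,0], ![0,0,0,1,0,0,0], ![0,0,1,0,0,0,0], ![0,1,0,0,0,0,0],
        ![1,0,0,0,0,1,1], ![1,0,0,1,1,0,0], ![1,0,1,0,1,0,1], ![1,0,1,1,0,1,0],
        ![1,1,0,0,1,1,0], ![1,1,0,1,0,0,1], ![1,1,1,0,0,0,0]} →
    ∀ P : Set (Fin 7 → ℝ), P = convexHull ℝ S →
      IsPolytope P ∧ pdim P = 7 ∧ vertexSet P = S ∧ TwoNeighborly P ∧
      (facetSet P).ncard = 16 := by
  rintro S hS P rfl
  have hS' : S = range FanoPolytope.vec := by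
    rw [hS]
    have hvec : FanoPolytope.vec = ![![0,0,0,0,0,0,0],
        ![0,0,0,0,0,0,1],
        ![0,0,0,0,0,1,0],
        ![0,0,0,0,1,0,0],
        ![0,0,0,1,0,0,0],
        ![0,0,1,0,0,0,0],
        ![0,1,0,0,0,0,0],
        ![1,0,0,0,0,1,1],
        ![1,0,0,1,1,0,0],
        ![1,0,1,0,1,0,1],
        ![1,0,1,1,0,1,0],
        ![1,1,0,0,1,1,0],
        ![1,1,0,1,0,0,1],
        ![1,1,1,0,0,0,0]] := by
      ext i k
      fin_cases i <;> fin_cases k <;> simp [FanoPolytope.vec, FanoPolytope.point]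
    simp only [hvec, Matrix.range_cons, Matrix.range_empty, union_empty, singleton_union]
  have hP : convexHull ℝ S = FanoPolytope.hull := by rw [hS', FanoPolytope.hull]
  rw [hP, FanoPolytope.pdim_hull, FanoPolytope.vertexSet_hull]
  refine ⟨⟨Finset.univ.image FanoPolytope.vec, ?_⟩, rfl, hS'.symm, ?_, ?_⟩
  · simp [FanoPolytope.hull]
  · intro u v hu hv huv
    refine ⟨?_, FanoPolytope.pdim_convexHull_pair huv⟩
    obtain ⟨i, rfl⟩ := FanoPolytope.vertexSet_hull.subset hu
    obtain ⟨k, rfl⟩ := FanoPolytope.vertexSet_hull.subset hv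
    exact FanoPolytope.isExposed_pair i k
  · have : facetSet FanoPolytope.hull = range FanoPolytope.face :=
      Set.ext FanoPolytope.isFacetOf_iff
    rw [this, ← image_univ, ncard_image_of_injective _ FanoPolytope.face_injective, ncard_univ]
    simp
end
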